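/- arXiv:2201.13255 — 4 statements merged into one kernel-verified Lean document; each statement's English description precedes it below -/
import Mathlib

section
/- Let a⁻ = a⁺ = 1. There exist constants c, C > 0 such that for all integers N⁻, N⁺ with 2 ≤ N⁻ ≤ N⁺, the spectral gap λ of the Metropolis chain for the measure π on {−N⁻,…,N⁺} satisfies c/(N⁺² + N⁻² log N⁻) ≤ λ ≤ C/(N⁺² + N⁻² log N⁻). -/
open Finset

/-- The unnormalized density `F(x) = (1+|x|)^{a⁻}` for `x ≤ 0` and
`(1+|x|)^{a⁺}` for `x > 0` on `ℤ`. -/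
noncomputable def metroF (am ap : ℝ) (x : ℤ) : ℝ :=
  if x ≤ 0 then ((1 + |x| : ℤ) : ℝ) ^ am else ((1 + |x| : ℤ) : ℝ) ^ ap

/-- The probability measure on `{-N⁻,…,N⁺}` proportional to `metroF`. -/
noncomputable def metroPi (am ap : ℝ) (Nm Np : ℤ) (x : ℤ) : ℝ :=
  metroF am ap x / ∑ y ∈ Finset.Icc (-Nm) Np, metroF am ap y

/-- Dirichlet form of the Metropolis chain for `metroPi` based on
nearest-neighbor random walk on `{-N⁻,…,N⁺}`. -/
noncomputable def metroDirichlet (am ap : ℝ) (Nm Np : ℤ) (u : ℤ → ℝ) : ℝ :=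
  ∑ x ∈ Finset.Icc (-Nm) (Np - 1),
    (u (x + 1) - u x) ^ 2 *
      (1 / 2 * min (metroPi am ap Nm Np x) (metroPi am ap Nm Np (x + 1)))

/-- Variance with respect to `metroPi`. -/
noncomputable def metroVar (am ap : ℝ) (Nm Np : ℤ) (u : ℤ → ℝ) : ℝ :=
  ∑ x ∈ Finset.Icc (-Nm) Np,
    (u x - ∑ y ∈ Finset.Icc (-Nm) Np, u y * metroPi am ap Nm Np y) ^ 2 *
      metroPi am ap Nm Np x

/-- Spectral gap of the Metropolis chain:
`λ = inf { ℰ(u,u)/Var_π(u) : Var_π(u) ≠ 0 }`. -/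
noncomputable def metroGap (am ap : ℝ) (Nm Np : ℤ) : ℝ :=
  sInf {r : ℝ | ∃ u : ℤ → ℝ, metroVar am ap Nm Np u ≠ 0 ∧
    r = metroDirichlet am ap Nm Np u / metroVar am ap Nm Np u}

/-- Harmonic sums as real numbers. -/
noncomputable def harmonicSum (n : ℕ) : ℝ := ∑ i ∈ range n, 1 / ((i : ℝ) + 1)

lemma harmonicSum_zero : harmonicSum 0 = 0 := by simp [harmonicSum]

lemma harmonicSum_succ (n : ℕ) : harmonicSum (n + 1) = harmonicSum n + 1 / ((n : ℝ) + 1) := by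
  simp [harmonicSum, sum_range_succ]

lemma harmonicSum_eq_harmonic (n : ℕ) : harmonicSum n = (harmonic n : ℝ) := by
  simp [harmonicSum, harmonic]

lemma harmonicSum_mono : Monotone harmonicSum :=
  monotone_nat_of_le_succ fun n => by
    rw [harmonicSum_succ]
    have : 0 ≤ 1 / ((n : ℝ) + 1) := by positivity
    linarith

lemma harmonicSum_nonneg (n : ℕ) : 0 ≤ harmonicSum n := by
  rw [← harmonicSum_zero]
  exact harmonicSum_mono (Nat.zero_le n)

lemma harmonicSum_le_one_add_log (n : ℕ) : harmonicSum n ≤ 1 + Real.log n := by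
  rw [harmonicSum_eq_harmonic]
  exact harmonic_le_one_add_log n

lemma log_le_harmonicSum (n : ℕ) (hn : 1 ≤ n) : Real.log n ≤ harmonicSum n := by
  rw [harmonicSum_eq_harmonic]
  refine le_trans ?_ (log_add_one_le_harmonic n)
  have : (1 : ℝ) ≤ n := by exact_mod_cast hn
  apply Real.log_le_log (by linarith)
  push_cast
  linarith

lemma one_le_harmonicSum_succ (n : ℕ) : 1 ≤ harmonicSum (n + 1) := by
  have h := harmonicSum_mono (show 1 ≤ n + 1 by omega)
  simpa [harmonicSum] using h

lemma sq_add_le_mul_add {a b r s D E : ℝ} (hr : 0 ≤ r) (hs : 0 ≤ s) (hD : 0 ≤ D) (hE : 0 ≤ E)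
    (ha : a ^ 2 ≤ r * D) (hb : b ^ 2 ≤ s * E) : (a + b) ^ 2 ≤ (r + s) * (D + E) := by
  have hrE : 0 ≤ r * E := mul_nonneg hr hE
  have hsD : 0 ≤ s * D := mul_nonneg hs hD
  have hab : (a * b) ^ 2 ≤ (r * E) * (s * D) := by
    calc (a * b) ^ 2 = a ^ 2 * b ^ 2 := by ring
      _ ≤ (r * D) * (s * E) := mul_le_mul ha hb (sq_nonneg b) (mul_nonneg hr hD)
      _ = _ := by ring
  have : 2 * (a * b) ≤ r * E + s * D := by
    refine (abs_le_of_sq_le_sq' ?_ (by positivity)).2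
    nlinarith [sq_nonneg (r * E - s * D)]
  nlinarith

/-- Energy of a sequence on `{0,…,n}` when the edge `{k,k+1}` has conductance `k+1`. -/
noncomputable def linearEnergy (v : ℕ → ℝ) (n : ℕ) : ℝ :=
  ∑ k ∈ range n, ((k : ℝ) + 1) * (v (k + 1) - v k) ^ 2

lemma linearEnergy_mono (v : ℕ → ℝ) : Monotone (linearEnergy v) :=
  monotone_nat_of_le_succ fun n => by
    rw [linearEnergy, linearEnergy, sum_range_succ]
    have : 0 ≤ ((n : ℝ) + 1) * (v (n + 1) - v n) ^ 2 := by positivity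
    linarith

lemma linearEnergy_zero (v : ℕ → ℝ) : linearEnergy v 0 = 0 := by simp [linearEnergy]

lemma linearEnergy_nonneg (v : ℕ → ℝ) (n : ℕ) : 0 ≤ linearEnergy v n :=
  sum_nonneg fun k _ => by positivity

lemma sq_sub_le_harmonicSum_mul_linearEnergy (v : ℕ → ℝ) {j n : ℕ} (h : j ≤ n) :
    (v n - v j) ^ 2 ≤ (harmonicSum n - harmonicSum j) * (linearEnergy v n - linearEnergy v j) := by
  induction n, h using Nat.le_induction with
  | base => simp
  | succ n hn ih =>
    have hd : (v (n + 1) - v n) ^ 2 ≤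
        (1 / ((n : ℝ) + 1)) * (((n : ℝ) + 1) * (v (n + 1) - v n) ^ 2) := by
      apply le_of_eq
      field_simp
    have := sq_add_le_mul_add (sub_nonneg.2 (harmonicSum_mono hn)) (by positivity)
      (sub_nonneg.2 (linearEnergy_mono v hn)) (by positivity) ih hd
    calc (v (n + 1) - v j) ^ 2 = (v n - v j + (v (n + 1) - v n)) ^ 2 := by ring
      _ ≤ _ := this
      _ = _ := by
        rw [harmonicSum_succ]
        simp only [linearEnergy, sum_range_succ]
        ring

lemma sq_sub_zero_le_harmonicSum_mul_linearEnergy (v : ℕ → ℝ) {m n : ℕ} (h : m ≤ n) :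
    (v m - v 0) ^ 2 ≤ harmonicSum n * linearEnergy v n := by
  have hm := sq_sub_le_harmonicSum_mul_linearEnergy v (Nat.zero_le m)
  rw [harmonicSum_zero, linearEnergy_zero, sub_zero, sub_zero] at hm
  exact hm.trans (mul_le_mul (harmonicSum_mono h) (linearEnergy_mono v h)
    (linearEnergy_nonneg v m) (harmonicSum_nonneg n))

lemma sum_range_one_add (n : ℕ) :
    ∑ k ∈ range n, (1 + (k : ℝ)) = n * (n + 1) / 2 := by
  induction n with
  | zero => simp
  | succ n ih =>
    rw [sum_range_succ, ih]
    push_cast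
    ring

lemma sum_range_two_add (n : ℕ) :
    ∑ k ∈ range n, (2 + (k : ℝ)) = n * (n + 3) / 2 := by
  induction n with
  | zero => simp
  | succ n ih =>
    rw [sum_range_succ, ih]
    push_cast
    ring

lemma sum_one_add_mul_harmonicSum_sub (n : ℕ) :
    ∑ j ∈ range (n + 1), (1 + (j : ℝ)) * (harmonicSum n - harmonicSum j) = n * (n + 3) / 4 := by
  induction n with
  | zero => simp
  | succ n ih =>
    have hs := sum_range_one_add (n + 1)
    have : ∀ j : ℕ, (1 + (j : ℝ)) * (harmonicSum (n + 1) - harmonicSum j) =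
        (1 + (j : ℝ)) * (harmonicSum n - harmonicSum j) + (1 + (j : ℝ)) * (1 / ((n : ℝ) + 1)) := by
      intro j
      rw [harmonicSum_succ]
      ring
    rw [sum_range_succ, sub_self, mul_zero, add_zero, sum_congr rfl fun j _ => this j,
      sum_add_distrib, ih, ← sum_mul, hs]
    push_cast
    field_simp
    ring

lemma sum_one_add_mul_sq_sub (n : ℕ) (μ : ℝ) :
    ∑ x ∈ range (n + 1), ((x : ℝ) - μ) ^ 2 * (1 + x) =
      n * (n + 1) * (n + 2) * (n + 3) / 36 + (n + 1) * (n + 2) / 2 * (μ - 2 * n / 3) ^ 2 := by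
  induction n with
  | zero => simp
  | succ n ih =>
    rw [sum_range_succ, ih]
    push_cast
    ring

lemma sq_mul_harmonicSum_sq_le (n : ℕ) :
    1 / 4 * (n : ℝ) ^ 2 * harmonicSum n ^ 2 ≤
      ∑ k ∈ range n, (2 + (k : ℝ)) * harmonicSum (k + 1) ^ 2 := by
  induction n with
  | zero => simp
  | succ n ih =>
    rw [sum_range_succ]
    refine le_trans ?_ (add_le_add_left ih _)
    have h1 := one_le_harmonicSum_succ n
    have e : harmonicSum n = harmonicSum (n + 1) - 1 / ((n : ℝ) + 1) := by
      rw [harmonicSum_succ]; ring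
    rw [e]
    set h := harmonicSum (n + 1)
    have hn : (0 : ℝ) ≤ n := n.cast_nonneg
    have hq : (n : ℝ) * (1 / ((n : ℝ) + 1)) ≤ 1 := by
      rw [mul_one_div, div_le_one (by positivity)]; linarith
    have hq0 : 0 ≤ (n : ℝ) * (1 / ((n : ℝ) + 1)) := by positivity
    set q := (n : ℝ) * (1 / ((n : ℝ) + 1))
    have e2 : (n : ℝ) ^ 2 * (h - 1 / ((n : ℝ) + 1)) ^ 2 = (n * h - q) ^ 2 := by ring
    push_cast
    rw [mul_assoc _ ((n : ℝ) ^ 2), e2]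
    nlinarith [mul_nonneg hn (mul_nonneg (by linarith : 0 ≤ h) (by linarith : 0 ≤ h - 1)),
      mul_nonneg (mul_nonneg hn (by linarith : 0 ≤ h)) (by linarith : 0 ≤ 1 - q), sq_nonneg q,
      sq_nonneg h, mul_nonneg hn (sq_nonneg h)]

lemma sum_Icc_neg_sub_one (f : ℤ → ℝ) (n p : ℕ) :
    ∑ x ∈ Icc (-(n : ℤ)) ((p : ℤ) - 1), f x =
      ∑ k ∈ range p, f k + ∑ k ∈ range n, f (-((k : ℤ) + 1)) := by
  induction p with
  | zero =>
    induction n with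
    | zero => simp
    | succ n ih =>
      have : Icc (-((n + 1 : ℕ) : ℤ)) (((0 : ℕ) : ℤ) - 1) =
          insert (-((n : ℤ) + 1)) (Icc (-(n : ℤ)) (((0 : ℕ) : ℤ) - 1)) := by
        ext x; simp only [mem_Icc, mem_insert]; omega
      rw [this, sum_insert (by simp), ih, sum_range_succ]
      ring
  | succ p ih =>
    have : Icc (-(n : ℤ)) (((p + 1 : ℕ) : ℤ) - 1) =
        insert (p : ℤ) (Icc (-(n : ℤ)) ((p : ℤ) - 1)) := by
      ext x; simp only [mem_Icc, mem_insert]; omega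
    rw [this, sum_insert (by simp), ih, sum_range_succ]
    ring

lemma sum_Icc_neg (f : ℤ → ℝ) (n p : ℕ) :
    ∑ x ∈ Icc (-(n : ℤ)) (p : ℤ), f x =
      ∑ k ∈ range (p + 1), f k + ∑ k ∈ range n, f (-((k : ℤ) + 1)) := by
  have := sum_Icc_neg_sub_one f n (p + 1)
  simpa using this

lemma metroF_one (x : ℤ) : metroF 1 1 x = 1 + |(x : ℝ)| := by
  simp [metroF]

lemma metroF_one_natCast (k : ℕ) : metroF 1 1 (k : ℤ) = 1 + k := by
  simp [metroF_one]

lemma metroF_one_neg_succ (k : ℕ) : metroF 1 1 (-((k : ℤ) + 1)) = 2 + k := by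
  rw [metroF_one]
  push_cast
  rw [abs_neg, abs_of_nonneg (by positivity)]
  ring

lemma metroF_one_pos (x : ℤ) : 0 < metroF 1 1 x := by
  rw [metroF_one]
  positivity

/-- The normalizing constant for `a⁻ = a⁺ = 1`. -/
noncomputable def metroZ (n p : ℕ) : ℝ := ∑ y ∈ Icc (-(n : ℤ)) (p : ℤ), metroF 1 1 y

lemma metroZ_pos (n p : ℕ) : 0 < metroZ n p :=
  sum_pos (fun x _ => metroF_one_pos x) ⟨0, by simp⟩

lemma metroZ_eq (n p : ℕ) :
    metroZ n p = (p + 1) * (p + 2) / 2 + n * (n + 3) / 2 := by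
  rw [metroZ, sum_Icc_neg]
  simp only [metroF_one_natCast, metroF_one_neg_succ]
  rw [sum_range_one_add, sum_range_two_add]
  push_cast
  ring

lemma metroPi_eq (n p : ℕ) (x : ℤ) : metroPi 1 1 n p x = metroF 1 1 x / metroZ n p := rfl

lemma sum_metroPi (n p : ℕ) : ∑ x ∈ Icc (-(n : ℤ)) (p : ℤ), metroPi 1 1 n p x = 1 := by
  simp only [metroPi_eq]
  rw [← sum_div]
  exact div_self (metroZ_pos n p).ne'

lemma metroPi_nonneg (n p : ℕ) (x : ℤ) : 0 ≤ metroPi 1 1 n p x := by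
  rw [metroPi_eq]
  exact div_nonneg (metroF_one_pos x).le (metroZ_pos n p).le

lemma metroVar_nonneg (n p : ℕ) (u : ℤ → ℝ) : 0 ≤ metroVar 1 1 n p u :=
  sum_nonneg fun x _ => mul_nonneg (sq_nonneg _) (metroPi_nonneg n p x)

lemma metroDirichlet_nonneg (n p : ℕ) (u : ℤ → ℝ) : 0 ≤ metroDirichlet 1 1 n p u :=
  sum_nonneg fun x _ => mul_nonneg (sq_nonneg _)
    (mul_nonneg (by norm_num) (le_min (metroPi_nonneg n p x) (metroPi_nonneg n p _)))

lemma metroDirichlet_eq (n p : ℕ) (u : ℤ → ℝ) :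
    metroDirichlet 1 1 n p u =
      (linearEnergy (fun k => u k) p + linearEnergy (fun k => u (-(k : ℤ))) n) /
        (2 * metroZ n p) := by
  have hZ := metroZ_pos n p
  rw [metroDirichlet, sum_Icc_neg_sub_one, linearEnergy, linearEnergy, add_div, sum_div, sum_div]
  congr 1
  · refine sum_congr rfl fun k _ => ?_
    have h : metroF 1 1 (k : ℤ) ≤ metroF 1 1 ((k : ℤ) + 1) := by
      have := metroF_one_natCast (k + 1)
      push_cast at this
      rw [this, metroF_one_natCast]
      linarith
    rw [metroPi_eq, metroPi_eq, min_eq_left (by gcongr), metroF_one_natCast]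
    push_cast
    field_simp
    ring
  · refine sum_congr rfl fun k _ => ?_
    have e : -((k : ℤ) + 1) + 1 = -(k : ℤ) := by ring
    have e2 : metroF 1 1 (-(k : ℤ)) = 1 + k := by simp [metroF_one]
    have h : metroF 1 1 (-(k : ℤ)) ≤ metroF 1 1 (-((k : ℤ) + 1)) := by
      rw [e2, metroF_one_neg_succ]
      linarith
    rw [e, metroPi_eq, metroPi_eq, min_eq_right (by gcongr), e2]
    push_cast
    field_simp
    ring

lemma metroVar_eq (n p : ℕ) (u : ℤ → ℝ) : ∃ μ : ℝ,
    metroVar 1 1 n p u =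
      (∑ k ∈ range (p + 1), (u k - μ) ^ 2 * (1 + (k : ℝ)) +
        ∑ k ∈ range n, (u (-((k : ℤ) + 1)) - μ) ^ 2 * (2 + (k : ℝ))) / metroZ n p := by
  refine ⟨∑ y ∈ Icc (-(n : ℤ)) (p : ℤ), u y * metroPi 1 1 n p y, ?_⟩
  rw [metroVar]
  generalize ∑ y ∈ Icc (-(n : ℤ)) (p : ℤ), u y * metroPi 1 1 n p y = μ
  rw [sum_Icc_neg, add_div, sum_div, sum_div]
  simp only [metroPi_eq, metroF_one_natCast, metroF_one_neg_succ, mul_div_assoc]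

lemma metroVar_le (n p : ℕ) (u : ℤ → ℝ) (c : ℝ) :
    metroVar 1 1 n p u ≤
      (∑ k ∈ range (p + 1), (u k - c) ^ 2 * (1 + (k : ℝ)) +
        ∑ k ∈ range n, (u (-((k : ℤ) + 1)) - c) ^ 2 * (2 + (k : ℝ))) / metroZ n p := by
  have h : metroVar 1 1 n p u ≤
      ∑ x ∈ Icc (-(n : ℤ)) (p : ℤ), (u x - c) ^ 2 * metroPi 1 1 n p x := by
    have h1 := sum_metroPi n p
    rw [metroVar]
    set μ := ∑ y ∈ Icc (-(n : ℤ)) (p : ℤ), u y * metroPi 1 1 n p y with hμ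
    have e : ∀ x, (u x - c) ^ 2 * metroPi 1 1 n p x = (u x - μ) ^ 2 * metroPi 1 1 n p x +
        (2 * (μ - c) * (u x * metroPi 1 1 n p x) + (c ^ 2 - μ ^ 2) * metroPi 1 1 n p x) := by
      intro x; ring
    rw [sum_congr rfl fun x _ => e x, sum_add_distrib, sum_add_distrib, ← mul_sum, ← mul_sum,
      h1, ← hμ]
    nlinarith [sq_nonneg (μ - c)]
  refine h.trans (le_of_eq ?_)
  rw [sum_Icc_neg, add_div, sum_div, sum_div]
  simp only [metroPi_eq, metroF_one_natCast, metroF_one_neg_succ, mul_div_assoc]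

lemma resistance_constant_le (n p : ℕ) (hn : 2 ≤ n) (hp : n ≤ p) :
    n * (n + 3) / 2 * (harmonicSum n + harmonicSum p) + p * (p + 3) / 4 ≤
      7 * ((p : ℝ) ^ 2 + (n : ℝ) ^ 2 * Real.log n) := by
  have hn2 : (2 : ℝ) ≤ n := by exact_mod_cast hn
  have hpn : (n : ℝ) ≤ p := by exact_mod_cast hp
  have hlog : Real.log p ≤ Real.log n + p / n := by
    have e : Real.log (p / n) = Real.log p - Real.log n :=
      Real.log_div (by linarith) (by linarith)
    have := Real.log_le_self (show (0 : ℝ) ≤ p / n by positivity)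
    linarith
  have hH : harmonicSum n + harmonicSum p ≤ 2 + 2 * Real.log n + p / n := by
    have := harmonicSum_le_one_add_log n
    have := harmonicSum_le_one_add_log p
    linarith
  have hl0 : 0 ≤ Real.log n := Real.log_nonneg (by linarith)
  have h1 : (n : ℝ) * (n + 3) / 2 * (harmonicSum n + harmonicSum p) ≤
      2 * (n : ℝ) ^ 2 * (2 + 2 * Real.log n + p / n) := by
    apply mul_le_mul _ hH (add_nonneg (harmonicSum_nonneg _) (harmonicSum_nonneg _))
      (by positivity)
    nlinarith
  have h2 : 2 * (n : ℝ) ^ 2 * (2 + 2 * Real.log n + p / n) =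
      4 * (n : ℝ) ^ 2 + 4 * ((n : ℝ) ^ 2 * Real.log n) + 2 * n * p := by
    field_simp
    ring
  nlinarith [mul_nonneg (sq_nonneg (n : ℝ)) hl0]

lemma metro_poincare (n p : ℕ) (hn : 2 ≤ n) (hp : n ≤ p) (u : ℤ → ℝ) :
    metroVar 1 1 n p u ≤
      14 * ((p : ℝ) ^ 2 + (n : ℝ) ^ 2 * Real.log n) * metroDirichlet 1 1 n p u := by
  have hZ := metroZ_pos n p
  refine (metroVar_le n p u (u p)).trans ?_
  rw [metroDirichlet_eq, mul_div_assoc', div_le_div_iff₀ hZ (by positivity)]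
  set R := linearEnergy (fun k => u k) p with hR
  set L := linearEnergy (fun k => u (-(k : ℤ))) n with hL
  have hR0 : 0 ≤ R := linearEnergy_nonneg _ _
  have hL0 : 0 ≤ L := linearEnergy_nonneg _ _
  have right : ∑ k ∈ range (p + 1), (u k - u p) ^ 2 * (1 + (k : ℝ)) ≤ p * (p + 3) / 4 * (R + L) := by
    rw [← sum_one_add_mul_harmonicSum_sub, sum_mul]
    refine sum_le_sum fun k hk => ?_
    have hk' : k ≤ p := by simpa [Nat.lt_succ_iff] using hk
    have h := sq_sub_le_harmonicSum_mul_linearEnergy (fun k : ℕ => u k) hk'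
    have h0 := linearEnergy_nonneg (fun k : ℕ => u k) k
    have h1 := sub_nonneg.2 (harmonicSum_mono hk')
    have : (u k - u p) ^ 2 ≤ (harmonicSum p - harmonicSum k) * (R + L) := by
      calc (u k - u p) ^ 2 = (u p - u k) ^ 2 := by ring
        _ ≤ _ := h
        _ ≤ _ := by gcongr; linarith
    calc (u k - u p) ^ 2 * (1 + (k : ℝ))
        ≤ (harmonicSum p - harmonicSum k) * (R + L) * (1 + (k : ℝ)) := by gcongr
      _ = _ := by ring
  have left : ∑ k ∈ range n, (u (-((k : ℤ) + 1)) - u p) ^ 2 * (2 + (k : ℝ)) ≤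
      n * (n + 3) / 2 * ((harmonicSum n + harmonicSum p) * (R + L)) := by
    rw [← sum_range_two_add, sum_mul]
    refine sum_le_sum fun k hk => ?_
    have hk' : k + 1 ≤ n := by simpa using hk
    have ha : (u (-((k : ℤ) + 1)) - u 0) ^ 2 ≤ harmonicSum n * L := by
      have h := sq_sub_zero_le_harmonicSum_mul_linearEnergy (fun k : ℕ => u (-(k : ℤ))) hk'
      simpa only [Nat.cast_add, Nat.cast_one, Nat.cast_zero, neg_zero] using h
    have hb : (u 0 - u p) ^ 2 ≤ harmonicSum p * R := by
      have h := sq_sub_zero_le_harmonicSum_mul_linearEnergy (fun k : ℕ => u k) le_rfl (n := p)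
      rw [← neg_sub, neg_sq]
      simpa only [Nat.cast_zero] using h
    have := sq_add_le_mul_add (harmonicSum_nonneg n) (harmonicSum_nonneg p) hL0 hR0 ha hb
    calc (u (-((k : ℤ) + 1)) - u p) ^ 2 * (2 + (k : ℝ))
        = (u (-((k : ℤ) + 1)) - u 0 + (u 0 - u p)) ^ 2 * (2 + (k : ℝ)) := by ring
      _ ≤ ((harmonicSum n + harmonicSum p) * (L + R)) * (2 + (k : ℝ)) := by gcongr
      _ = _ := by ring
  have key := resistance_constant_le n p hn hp
  have total := mul_le_mul_of_nonneg_right key (add_nonneg hR0 hL0)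
  have := mul_le_mul_of_nonneg_right (add_le_add right left) (mul_nonneg zero_le_two hZ.le)
  refine this.trans ?_
  have := mul_le_mul_of_nonneg_right total (mul_nonneg zero_le_two hZ.le)
  linarith

lemma metroGap_le (n p : ℕ) (u : ℤ → ℝ) (D V : ℝ) (hV : 0 < V)
    (hD : metroDirichlet 1 1 n p u ≤ D) (hVar : V ≤ metroVar 1 1 n p u) :
    metroGap 1 1 n p ≤ D / V := by
  have hb : BddBelow {r : ℝ | ∃ u : ℤ → ℝ, metroVar 1 1 n p u ≠ 0 ∧
      r = metroDirichlet 1 1 n p u / metroVar 1 1 n p u} := by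
    refine ⟨0, ?_⟩
    rintro r ⟨u, -, rfl⟩
    exact div_nonneg (metroDirichlet_nonneg n p u) (metroVar_nonneg n p u)
  refine (csInf_le hb ⟨u, (hV.trans_le hVar).ne', rfl⟩).trans ?_
  have := (metroDirichlet_nonneg n p u).trans hD
  gcongr

lemma metroVar_cast_ge (n p : ℕ) (hp : n ≤ p) :
    (p : ℝ) ^ 2 / 36 ≤ metroVar 1 1 n p (fun x => (x : ℝ)) := by
  obtain ⟨μ, h⟩ := metroVar_eq n p (fun x => (x : ℝ))
  have hpn : (n : ℝ) ≤ p := by exact_mod_cast hp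
  have hn0 : (0 : ℝ) ≤ n := n.cast_nonneg
  have hZ := metroZ_pos n p
  rw [h, le_div_iff₀ hZ]
  have hl : 0 ≤ ∑ k ∈ range n, (((-((k : ℤ) + 1) : ℤ) : ℝ) - μ) ^ 2 * (2 + (k : ℝ)) :=
    sum_nonneg fun k _ => by positivity
  have hr := sum_one_add_mul_sq_sub p μ
  have hq : 0 ≤ ((p : ℝ) + 1) * (p + 2) / 2 * (μ - 2 * p / 3) ^ 2 := by positivity
  have hZle : metroZ n p ≤ ((p : ℝ) + 1) * (p + 2) := by
    rw [metroZ_eq]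
    nlinarith
  have : (p : ℝ) ^ 2 / 36 * metroZ n p ≤ p * (p + 1) * (p + 2) * (p + 3) / 36 := by
    refine (mul_le_mul_of_nonneg_left hZle (by positivity)).trans ?_
    have : (0 : ℝ) ≤ p * (p + 1) * (p + 2) := by positivity
    nlinarith
  simp only [Int.cast_natCast]
  linarith

lemma metroDirichlet_cast_le (n p : ℕ) :
    metroDirichlet 1 1 n p (fun x => (x : ℝ)) ≤ 1 / 2 := by
  have hZ := metroZ_pos n p
  rw [metroDirichlet_eq, div_le_iff₀ (by positivity), metroZ_eq]
  have h1 : linearEnergy (fun k => (((k : ℕ) : ℤ) : ℝ)) p = p * (p + 1) / 2 := by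
    rw [← sum_range_one_add, linearEnergy]
    exact sum_congr rfl fun k _ => by push_cast; ring
  have h2 : linearEnergy (fun k => ((-((k : ℕ) : ℤ) : ℤ) : ℝ)) n = n * (n + 1) / 2 := by
    rw [← sum_range_one_add, linearEnergy]
    exact sum_congr rfl fun k _ => by push_cast; ring
  rw [h1, h2]
  have : (0 : ℝ) ≤ n := n.cast_nonneg
  have : (0 : ℝ) ≤ p := p.cast_nonneg
  nlinarith

lemma metroGap_le_sq (n p : ℕ) (hn : 2 ≤ n) (hp : n ≤ p) :
    metroGap 1 1 n p * (p : ℝ) ^ 2 ≤ 18 := by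
  have hp0 : (0 : ℝ) < p := by exact_mod_cast (by omega : 0 < p)
  have h := metroGap_le n p _ _ _ (by positivity) (metroDirichlet_cast_le n p)
    (metroVar_cast_ge n p hp)
  rw [← le_div_iff₀ (by positivity)]
  refine h.trans (le_of_eq ?_)
  field_simp
  norm_num

/-- Test function vanishing on `x ≥ 0` and harmonic on `x < 0`. -/
noncomputable def harmonicTest (x : ℤ) : ℝ := harmonicSum (-x).toNat

lemma harmonicTest_natCast (k : ℕ) : harmonicTest k = 0 := by
  have : (-(k : ℤ)).toNat = 0 := by omega
  rw [harmonicTest, this, harmonicSum_zero]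

lemma harmonicTest_neg (k : ℕ) : harmonicTest (-(k : ℤ)) = harmonicSum k := by
  simp [harmonicTest]

lemma metroDirichlet_harmonicTest (n p : ℕ) :
    metroDirichlet 1 1 n p harmonicTest = harmonicSum n / (2 * metroZ n p) := by
  rw [metroDirichlet_eq]
  simp only [harmonicTest_natCast, harmonicTest_neg, linearEnergy, harmonicSum_succ]
  congr 1
  simp only [sub_self, ne_eq, OfNat.ofNat_ne_zero, not_false_eq_true, zero_pow, mul_zero,
    sum_const_zero, zero_add, add_sub_cancel_left]
  exact sum_congr rfl fun k _ => by field_simp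

lemma metroVar_harmonicTest_ge (n p : ℕ) (hp : n ≤ p) :
    (n : ℝ) ^ 2 * harmonicSum n ^ 2 / (8 * metroZ n p) ≤ metroVar 1 1 n p harmonicTest := by
  obtain ⟨μ, h⟩ := metroVar_eq n p harmonicTest
  have hZ := metroZ_pos n p
  have hs : ∀ k : ℕ, harmonicTest (-((k : ℤ) + 1)) = harmonicSum (k + 1) := fun k => by
    have := harmonicTest_neg (k + 1)
    push_cast at this
    exact this
  rw [h, div_le_div_iff₀ (by positivity) hZ]
  simp only [harmonicTest_natCast, hs]
  have h1 : ∑ k ∈ range n, μ ^ 2 * (2 + (k : ℝ)) ≤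
      ∑ k ∈ range (p + 1), (0 - μ) ^ 2 * (1 + (k : ℝ)) := by
    rw [sum_range_succ']
    have : ∑ k ∈ range n, μ ^ 2 * (2 + (k : ℝ)) ≤ ∑ k ∈ range p, μ ^ 2 * (2 + (k : ℝ)) :=
      sum_le_sum_of_subset_of_nonneg (range_mono hp) fun k _ _ => by positivity
    have e : ∑ k ∈ range p, (0 - μ) ^ 2 * (1 + ((k + 1 : ℕ) : ℝ)) =
        ∑ k ∈ range p, μ ^ 2 * (2 + (k : ℝ)) :=
      sum_congr rfl fun k _ => by push_cast; ring
    rw [e]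
    have : 0 ≤ (0 - μ) ^ 2 * (1 + ((0 : ℕ) : ℝ)) := by positivity
    linarith
  have h2 := sq_mul_harmonicSum_sq_le n
  have h3 : 1 / 2 * ∑ k ∈ range n, (2 + (k : ℝ)) * harmonicSum (k + 1) ^ 2 ≤
      ∑ k ∈ range n, μ ^ 2 * (2 + (k : ℝ)) +
        ∑ k ∈ range n, (harmonicSum (k + 1) - μ) ^ 2 * (2 + (k : ℝ)) := by
    rw [mul_sum, ← sum_add_distrib]
    refine sum_le_sum fun k _ => ?_
    have : (0 : ℝ) ≤ 2 + k := by positivity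
    nlinarith [mul_nonneg this (sq_nonneg (harmonicSum (k + 1) - 2 * μ))]
  have : (n : ℝ) ^ 2 * harmonicSum n ^ 2 ≤
      8 * (∑ k ∈ range (p + 1), (0 - μ) ^ 2 * (1 + (k : ℝ)) +
        ∑ k ∈ range n, (harmonicSum (k + 1) - μ) ^ 2 * (2 + (k : ℝ))) := by linarith
  have := mul_le_mul_of_nonneg_right this hZ.le
  linarith

lemma metroGap_le_sq_mul_log (n p : ℕ) (hn : 2 ≤ n) (hp : n ≤ p) :
    metroGap 1 1 n p * ((n : ℝ) ^ 2 * Real.log n) ≤ 4 := by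
  have hn0 : (1 : ℝ) < n := by exact_mod_cast (by omega : 1 < n)
  have hl : 0 < Real.log n := Real.log_pos hn0
  have hH := log_le_harmonicSum n (by omega)
  have hH0 : 0 < harmonicSum n := hl.trans_le hH
  have hZ := metroZ_pos n p
  have h := metroGap_le n p _ _ _ (by positivity) (metroDirichlet_harmonicTest n p).le
    (metroVar_harmonicTest_ge n p hp)
  rw [← le_div_iff₀ (by positivity)]
  refine h.trans ?_
  have e : harmonicSum n / (2 * metroZ n p) / ((n : ℝ) ^ 2 * harmonicSum n ^ 2 / (8 * metroZ n p)) =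
      4 / ((n : ℝ) ^ 2 * harmonicSum n) := by
    field_simp
    norm_num
  rw [e]
  gcongr

/-- Lemma `lem-2`, third case: for `a⁻ = a⁺ = 1` and
`2 ≤ N⁻ ≤ N⁺`, the spectral gap is of order `1/(N⁺² + N⁻² log N⁻)`. -/
theorem gap_asymmetric_critical_both :
    ∃ c C : ℝ, 0 < c ∧ 0 < C ∧ ∀ Nm Np : ℤ, 2 ≤ Nm → Nm ≤ Np →
      c / ((Np : ℝ) ^ 2 + (Nm : ℝ) ^ 2 * Real.log Nm) ≤ metroGap 1 1 Nm Np ∧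
      metroGap 1 1 Nm Np ≤ C / ((Np : ℝ) ^ 2 + (Nm : ℝ) ^ 2 * Real.log Nm) := by
  refine ⟨1 / 14, 22, by norm_num, by norm_num, fun Nm Np hm hp => ?_⟩
  lift Nm to ℕ using by omega with n
  lift Np to ℕ using by omega with p
  have hn : 2 ≤ n := by exact_mod_cast hm
  have hnp : n ≤ p := by exact_mod_cast hp
  simp only [Int.cast_natCast]
  have hn1 : (1 : ℝ) < n := by exact_mod_cast (by omega : 1 < n)
  have hp0 : (0 : ℝ) < p := by exact_mod_cast (by omega : 0 < p)
  have hl : 0 < Real.log n := Real.log_pos hn1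
  have hpos : 0 < (p : ℝ) ^ 2 + (n : ℝ) ^ 2 * Real.log n := by positivity
  constructor
  · refine le_csInf ?_ ?_
    · have := metroVar_cast_ge n p hnp
      have h0 : 0 < (p : ℝ) ^ 2 / 36 := by positivity
      exact ⟨_, _, (h0.trans_le this).ne', rfl⟩
    · rintro r ⟨u, hu, rfl⟩
      have hv := (metroVar_nonneg n p u).lt_of_ne' hu
      have := metro_poincare n p hn hnp u
      rw [div_le_div_iff₀ hpos hv]
      linarith
  · rw [le_div_iff₀ hpos]
    have := metroGap_le_sq n p hn hnp
    have := metroGap_le_sq_mul_log n p hn hnp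
    linarith
end

section
/- Let a⁻ = 1 and a⁺ > 1. There exist constants c, C > 0 depending only on a⁺ such that for all integers N⁻, N⁺ ≥ 2, the spectral gap λ of the Metropolis chain for the measure π on {−N⁻,…,N⁺} satisfies c·m ≤ λ ≤ C·m, where m = max{ 1/(N⁺² + N⁻² log N⁻), 1/(N⁻² + N⁺^{1+a⁺} log N⁺) }. -/
open Finset

/-- The unnormalized Dirichlet form, `2 Z ℰ(u,u)` with `Z` the total mass of `metroF`. -/
noncomputable def metroEnergy (am ap : ℝ) (Nm Np : ℤ) (u : ℤ → ℝ) : ℝ :=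
  ∑ x ∈ Finset.Icc (-Nm) (Np - 1),
    (u (x + 1) - u x) ^ 2 * min (metroF am ap x) (metroF am ap (x + 1))

section General

variable {am ap : ℝ} {Nm Np : ℤ}

lemma metroF_of_nonneg {x : ℤ} (hx : 0 ≤ x) : metroF am ap x = ((x : ℝ) + 1) ^ ap := by
  unfold metroF
  split_ifs with h
  · obtain rfl : x = 0 := le_antisymm h hx
    simp
  · rw [abs_of_nonneg hx]
    push_cast
    rw [add_comm]

lemma metroF_neg (x : ℤ) : metroF am ap (-x) = metroF ap am x := by
  unfold metroF
  rcases lt_trichotomy x 0 with h | h | h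
  · rw [if_neg (by omega), if_pos h.le, abs_neg]
  · simp [h]
  · rw [if_pos (by omega), if_neg (by omega), abs_neg]

lemma metroF_pos (x : ℤ) : 0 < metroF am ap x := by
  have h : (0 : ℝ) < ((1 + |x| : ℤ) : ℝ) := by
    have := abs_nonneg x
    exact_mod_cast (by omega : 0 < 1 + |x|)
  unfold metroF
  split_ifs <;> exact Real.rpow_pos_of_pos h _

lemma metroF_neg_natCast (i : ℕ) : metroF am ap (-(i : ℤ)) = ((i : ℝ) + 1) ^ am := by
  rw [metroF_neg, metroF_of_nonneg (by positivity)]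
  simp

lemma min_metroF_of_nonneg (hap : 0 ≤ ap) {x : ℤ} (hx : 0 ≤ x) :
    min (metroF am ap x) (metroF am ap (x + 1)) = ((x : ℝ) + 1) ^ ap := by
  have hx' : (0 : ℝ) ≤ x := by exact_mod_cast hx
  rw [metroF_of_nonneg hx, metroF_of_nonneg (by omega)]
  refine min_eq_left (Real.rpow_le_rpow (by positivity) ?_ hap)
  push_cast
  linarith

lemma min_metroF_neg (ham : 0 ≤ am) (i : ℕ) :
    min (metroF am ap (-(i : ℤ) - 1)) (metroF am ap (-(i : ℤ) - 1 + 1)) = ((i : ℝ) + 1) ^ am := by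
  have h1 : -(i : ℤ) - 1 = -((i : ℤ) + 1) := by ring
  have h2 : -(i : ℤ) - 1 + 1 = -(i : ℤ) := by ring
  rw [h2, h1, metroF_neg, metroF_neg, min_comm, min_metroF_of_nonneg ham (by positivity)]
  simp

lemma min_metroF_pos (x : ℤ) : 0 < min (metroF am ap x) (metroF am ap (x + 1)) :=
  lt_min (metroF_pos _) (metroF_pos _)

lemma sum_Ico_neg_natCast (f : ℤ → ℝ) (n p : ℕ) :
    ∑ x ∈ Finset.Ico (-(n : ℤ)) p, f x =
      ∑ i ∈ Finset.range n, f (-(i : ℤ) - 1) + ∑ i ∈ Finset.range p, f i := by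
  induction n with
  | zero =>
    rw [Finset.sum_range_zero, zero_add, Nat.cast_zero, neg_zero]
    symm
    refine Finset.sum_nbij' (fun i => (i : ℤ)) Int.toNat ?_ ?_ ?_ ?_ ?_ <;>
      intro i hi <;> simp only [Finset.mem_range, Finset.mem_Ico] at hi ⊢ <;> omega
  | succ n ih =>
    have h : Finset.Ico (-((n + 1 : ℕ) : ℤ)) p =
        insert (-(n : ℤ) - 1) (Finset.Ico (-(n : ℤ)) p) := by
      ext x
      simp only [Finset.mem_Ico, Finset.mem_insert]
      omega
    rw [h, Finset.sum_insert (by simp), ih, Finset.sum_range_succ]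
    ring

lemma sum_Icc_neg_natCast (f : ℤ → ℝ) (n p : ℕ) :
    ∑ x ∈ Finset.Icc (-(n : ℤ)) p, f x =
      ∑ i ∈ Finset.range n, f (-(i : ℤ) - 1) + ∑ i ∈ Finset.range (p + 1), f i := by
  rw [← sum_Ico_neg_natCast]
  refine Finset.sum_congr ?_ fun _ _ => rfl
  ext x
  simp only [Finset.mem_Ico, Finset.mem_Icc]
  omega

lemma sum_Icc_neg_natCast_sub_one (f : ℤ → ℝ) (n p : ℕ) :
    ∑ x ∈ Finset.Icc (-(n : ℤ)) ((p : ℤ) - 1), f x =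
      ∑ i ∈ Finset.range n, f (-(i : ℤ) - 1) + ∑ i ∈ Finset.range p, f i := by
  rw [← sum_Ico_neg_natCast]
  refine Finset.sum_congr ?_ fun _ _ => rfl
  ext x
  simp only [Finset.mem_Ico, Finset.mem_Icc]
  omega

lemma metroZ_pos_s11 (h0 : 0 ≤ Nm) (h1 : 0 ≤ Np) :
    0 < ∑ y ∈ Finset.Icc (-Nm) Np, metroF am ap y :=
  Finset.sum_pos (fun _ _ => metroF_pos _) ⟨0, by simp [h0, h1]⟩

lemma metroDirichlet_eq_s11 (h0 : 0 ≤ Nm) (h1 : 0 ≤ Np) (u : ℤ → ℝ) :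
    metroDirichlet am ap Nm Np u =
      metroEnergy am ap Nm Np u / (2 * ∑ y ∈ Finset.Icc (-Nm) Np, metroF am ap y) := by
  have hZ := metroZ_pos_s11 (am := am) (ap := ap) h0 h1
  unfold metroDirichlet metroEnergy metroPi
  rw [Finset.sum_div]
  refine Finset.sum_congr rfl fun x _ => ?_
  rw [min_div_div_right hZ.le]
  field_simp

lemma metroVar_eq_s11 (u : ℤ → ℝ) :
    metroVar am ap Nm Np u =
      (∑ x ∈ Finset.Icc (-Nm) Np,
        (u x - ∑ y ∈ Finset.Icc (-Nm) Np, u y * metroPi am ap Nm Np y) ^ 2 * metroF am ap x) /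
        ∑ y ∈ Finset.Icc (-Nm) Np, metroF am ap y := by
  rw [Finset.sum_div]
  exact Finset.sum_congr rfl fun x _ => by rw [metroPi, mul_div_assoc]

lemma sum_metroPi_s11 (h0 : 0 ≤ Nm) (h1 : 0 ≤ Np) :
    ∑ y ∈ Finset.Icc (-Nm) Np, metroPi am ap Nm Np y = 1 := by
  unfold metroPi
  rw [← Finset.sum_div, div_self (metroZ_pos_s11 h0 h1).ne']

lemma metroVar_le_s11 (h0 : 0 ≤ Nm) (h1 : 0 ≤ Np) (u : ℤ → ℝ) (c : ℝ) :
    metroVar am ap Nm Np u ≤ (∑ x ∈ Finset.Icc (-Nm) Np, (u x - c) ^ 2 * metroF am ap x) /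
        ∑ y ∈ Finset.Icc (-Nm) Np, metroF am ap y := by
  have hs : (∑ x ∈ Finset.Icc (-Nm) Np, (u x - c) ^ 2 * metroF am ap x) /
        ∑ y ∈ Finset.Icc (-Nm) Np, metroF am ap y =
      ∑ x ∈ Finset.Icc (-Nm) Np, (u x - c) ^ 2 * metroPi am ap Nm Np x := by
    rw [Finset.sum_div]
    exact Finset.sum_congr rfl fun x _ => by rw [metroPi, mul_div_assoc]
  rw [hs, metroVar]
  set m := ∑ y ∈ Finset.Icc (-Nm) Np, u y * metroPi am ap Nm Np y with hm
  have key : ∑ x ∈ Finset.Icc (-Nm) Np, (u x - c) ^ 2 * metroPi am ap Nm Np x =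
      ∑ x ∈ Finset.Icc (-Nm) Np, (u x - m) ^ 2 * metroPi am ap Nm Np x + (m - c) ^ 2 := by
    have e : ∀ x, (u x - c) ^ 2 * metroPi am ap Nm Np x =
        (u x - m) ^ 2 * metroPi am ap Nm Np x + 2 * (m - c) * (u x * metroPi am ap Nm Np x) +
          ((c ^ 2 - m ^ 2) * metroPi am ap Nm Np x) := fun x => by ring
    rw [Finset.sum_congr rfl fun x _ => e x, Finset.sum_add_distrib, Finset.sum_add_distrib,
      ← Finset.mul_sum, ← Finset.mul_sum, ← hm, sum_metroPi_s11 h0 h1]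
    ring
  rw [key]
  exact le_add_of_nonneg_right (sq_nonneg _)

lemma metroEnergy_nonneg (u : ℤ → ℝ) : 0 ≤ metroEnergy am ap Nm Np u :=
  Finset.sum_nonneg fun _ _ => mul_nonneg (sq_nonneg _) (min_metroF_pos _).le

/-- A function separating two sets of mass at least `m` has large second moment around any
point. -/
lemma le_sum_sq_sub_mul_metroF {S T : Finset ℤ} (hS : S ⊆ Finset.Icc (-Nm) Np)
    (hT : T ⊆ Finset.Icc (-Nm) Np) {u : ℤ → ℝ} {α β m : ℝ} (hαβ : α < β)
    (huS : ∀ x ∈ S, u x ≤ α) (huT : ∀ x ∈ T, β ≤ u x)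
    (hmS : m ≤ ∑ x ∈ S, metroF am ap x) (hmT : m ≤ ∑ x ∈ T, metroF am ap x) (c : ℝ) :
    (β - α) ^ 2 / 4 * m ≤ ∑ x ∈ Finset.Icc (-Nm) Np, (u x - c) ^ 2 * metroF am ap x := by
  have main : ∀ R : Finset ℤ, R ⊆ Finset.Icc (-Nm) Np → m ≤ ∑ x ∈ R, metroF am ap x →
      (∀ x ∈ R, (β - α) ^ 2 / 4 ≤ (u x - c) ^ 2) →
      (β - α) ^ 2 / 4 * m ≤
        ∑ x ∈ Finset.Icc (-Nm) Np, (u x - c) ^ 2 * metroF am ap x := by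
    intro R hR hm hu
    calc (β - α) ^ 2 / 4 * m ≤ (β - α) ^ 2 / 4 * ∑ x ∈ R, metroF am ap x := by gcongr
      _ = ∑ x ∈ R, (β - α) ^ 2 / 4 * metroF am ap x := Finset.mul_sum _ _ _
      _ ≤ ∑ x ∈ R, (u x - c) ^ 2 * metroF am ap x :=
        Finset.sum_le_sum fun x hx => mul_le_mul_of_nonneg_right (hu x hx) (metroF_pos x).le
      _ ≤ _ := Finset.sum_le_sum_of_subset_of_nonneg hR fun x _ _ =>
        mul_nonneg (sq_nonneg _) (metroF_pos x).le
  rcases le_total c ((α + β) / 2) with h | h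
  · exact main T hT hmT fun x hx => by nlinarith [huT x hx]
  · exact main S hS hmS fun x hx => by nlinarith [huS x hx]

/-- Upper bound on the spectral gap from a test function separating two sets. -/
lemma metroGap_le_of_separating (h0 : 0 ≤ Nm) (h1 : 0 ≤ Np) {S T : Finset ℤ}
    (hS : S ⊆ Finset.Icc (-Nm) Np) (hT : T ⊆ Finset.Icc (-Nm) Np) {u : ℤ → ℝ} {α β m d : ℝ}
    (hαβ : α < β) (hm : 0 < m) (huS : ∀ x ∈ S, u x ≤ α) (huT : ∀ x ∈ T, β ≤ u x)
    (hmS : m ≤ ∑ x ∈ S, metroF am ap x) (hmT : m ≤ ∑ x ∈ T, metroF am ap x)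
    (hd : metroEnergy am ap Nm Np u ≤ d) :
    metroGap am ap Nm Np ≤ 2 * d / ((β - α) ^ 2 * m) := by
  have hZ := metroZ_pos_s11 (am := am) (ap := ap) h0 h1
  have hV := le_sum_sq_sub_mul_metroF hS hT hαβ huS huT hmS hmT
    (∑ y ∈ Finset.Icc (-Nm) Np, u y * metroPi am ap Nm Np y)
  have hb : 0 < (β - α) ^ 2 / 4 * m := by
    have := sub_pos.2 hαβ
    positivity
  have hvar := metroVar_eq_s11 (am := am) (ap := ap) (Nm := Nm) (Np := Np) u
  have hE := metroDirichlet_eq_s11 (am := am) (ap := ap) h0 h1 u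
  have hE0 := metroEnergy_nonneg (am := am) (ap := ap) (Nm := Nm) (Np := Np) u
  set Z := ∑ y ∈ Finset.Icc (-Nm) Np, metroF am ap y
  set V := ∑ x ∈ Finset.Icc (-Nm) Np,
        (u x - ∑ y ∈ Finset.Icc (-Nm) Np, u y * metroPi am ap Nm Np y) ^ 2 * metroF am ap x
  have hVpos : 0 < V := hb.trans_le hV
  have hd0 : 0 ≤ d := hE0.trans hd
  have hbdd : BddBelow {r : ℝ | ∃ u : ℤ → ℝ, metroVar am ap Nm Np u ≠ 0 ∧
      r = metroDirichlet am ap Nm Np u / metroVar am ap Nm Np u} := by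
    refine ⟨0, ?_⟩
    rintro r ⟨v, -, rfl⟩
    rw [metroDirichlet_eq_s11 h0 h1, metroVar_eq_s11]
    exact div_nonneg (div_nonneg (metroEnergy_nonneg _) (by positivity))
      (div_nonneg (Finset.sum_nonneg fun x _ => mul_nonneg (sq_nonneg _) (metroF_pos x).le) hZ.le)
  refine (csInf_le hbdd ⟨u, ?_, rfl⟩).trans ?_
  · rw [hvar]
    positivity
  · rw [hvar, hE]
    calc metroEnergy am ap Nm Np u / (2 * Z) / (V / Z) = metroEnergy am ap Nm Np u / 2 / V := by
          field_simp
      _ ≤ d / 2 / ((β - α) ^ 2 / 4 * m) := by gcongr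
      _ = 2 * d / ((β - α) ^ 2 * m) := by
          have := sub_pos.2 hαβ
          field_simp
          ring

/-- Lower bound on the spectral gap from an unnormalized Poincaré inequality. -/
lemma le_metroGap_of_poincare (h0 : 0 ≤ Nm) (h1 : 1 ≤ Np) {K : ℝ} (hK : 0 < K)
    (h : ∀ u : ℤ → ℝ, ∃ c : ℝ, ∑ x ∈ Finset.Icc (-Nm) Np, (u x - c) ^ 2 * metroF am ap x ≤
      K * metroEnergy am ap Nm Np u) :
    1 / (2 * K) ≤ metroGap am ap Nm Np := by
  have h1' : 0 ≤ Np := by omega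
  have hZ := metroZ_pos_s11 (am := am) (ap := ap) h0 h1'
  refine le_csInf ?_ ?_
  · refine ⟨_, fun x => (x : ℝ), ?_, rfl⟩
    rw [metroVar_eq_s11]
    refine (div_pos (lt_of_lt_of_le ?_ (le_sum_sq_sub_mul_metroF (S := {0}) (T := {1}) (α := 0)
      (β := 1) (m := min (metroF am ap 0) (metroF am ap 1)) ?_ ?_ one_pos ?_ ?_ ?_ ?_ _)) hZ).ne'
    · have := lt_min (metroF_pos (am := am) (ap := ap) 0) (metroF_pos (am := am) (ap := ap) 1)
      positivity
    · simp [h0, h1']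
    · simp only [Finset.singleton_subset_iff, Finset.mem_Icc]
      omega
    · simp
    · simp
    · simp
    · simp
  · rintro r ⟨u, hu, rfl⟩
    obtain ⟨c, hc⟩ := h u
    have hV0 : 0 ≤ metroVar am ap Nm Np u := by
      rw [metroVar_eq_s11]
      exact div_nonneg
        (Finset.sum_nonneg fun x _ => mul_nonneg (sq_nonneg _) (metroF_pos x).le) hZ.le
    have hV := hV0.lt_of_ne' hu
    rw [le_div_iff₀ hV, metroDirichlet_eq_s11 h0 h1']
    have hle := (metroVar_le_s11 h0 h1' u c).trans (div_le_div_of_nonneg_right hc hZ.le)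
    calc 1 / (2 * K) * metroVar am ap Nm Np u
        ≤ 1 / (2 * K) * (K * metroEnergy am ap Nm Np u /
            ∑ y ∈ Finset.Icc (-Nm) Np, metroF am ap y) := by gcongr
      _ = _ := by field_simp

end General

section Reflection

variable {am ap : ℝ} {Nm Np : ℤ}

lemma sum_Icc_neg_comp (f : ℤ → ℝ) (a b : ℤ) :
    ∑ x ∈ Finset.Icc (-a) b, f x = ∑ x ∈ Finset.Icc (-b) a, f (-x) := by
  refine Finset.sum_nbij' (fun x => -x) (fun x => -x) ?_ ?_ ?_ ?_ ?_ <;> intro x hx <;>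
    simp only [Finset.mem_Icc, neg_neg] at hx ⊢ <;> omega

lemma metroPi_neg (x : ℤ) : metroPi am ap Nm Np (-x) = metroPi ap am Np Nm x := by
  unfold metroPi
  rw [metroF_neg, sum_Icc_neg_comp]
  simp only [metroF_neg]

lemma metroVar_comp_neg (u : ℤ → ℝ) :
    metroVar am ap Nm Np (fun x => u (-x)) = metroVar ap am Np Nm u := by
  have h : ∑ y ∈ Finset.Icc (-Nm) Np, u (-y) * metroPi am ap Nm Np y =
      ∑ y ∈ Finset.Icc (-Np) Nm, u y * metroPi ap am Np Nm y := by
    rw [sum_Icc_neg_comp]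
    simp only [neg_neg, metroPi_neg]
  unfold metroVar
  rw [h, sum_Icc_neg_comp]
  simp only [neg_neg, metroPi_neg]

lemma metroDirichlet_comp_neg (u : ℤ → ℝ) :
    metroDirichlet am ap Nm Np (fun x => u (-x)) = metroDirichlet ap am Np Nm u := by
  unfold metroDirichlet
  refine Finset.sum_nbij' (fun x => -x - 1) (fun x => -x - 1) ?_ ?_ ?_ ?_ ?_ <;> intro x hx
  · simp only [Finset.mem_Icc] at hx ⊢
    omega
  · simp only [Finset.mem_Icc] at hx ⊢
    omega
  · ring
  · ring
  · have h1 : -x - 1 + 1 = -x := by ring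
    have h2 : -x - 1 = -(x + 1) := by ring
    rw [h1, h2, metroPi_neg, metroPi_neg, min_comm]
    ring

lemma metroGap_symm : metroGap am ap Nm Np = metroGap ap am Np Nm := by
  have key : ∀ (am ap : ℝ) (Nm Np : ℤ), {r : ℝ | ∃ u : ℤ → ℝ, metroVar am ap Nm Np u ≠ 0 ∧
      r = metroDirichlet am ap Nm Np u / metroVar am ap Nm Np u} ⊆
      {r : ℝ | ∃ u : ℤ → ℝ, metroVar ap am Np Nm u ≠ 0 ∧
      r = metroDirichlet ap am Np Nm u / metroVar ap am Np Nm u} := by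
    rintro am ap Nm Np r ⟨u, hu, rfl⟩
    refine ⟨fun x => u (-x), ?_, ?_⟩
    · rwa [metroVar_comp_neg]
    · rw [metroVar_comp_neg, metroDirichlet_comp_neg]
  exact congrArg sInf ((key _ _ _ _).antisymm (key _ _ _ _))

end Reflection

section LowerBound

variable {am ap : ℝ}

lemma sum_Ico_int_sub (u : ℤ → ℝ) {x y : ℤ} (h : x ≤ y) :
    ∑ e ∈ Finset.Ico x y, (u (e + 1) - u e) = u y - u x := by
  induction y, h using Int.leInduction with
  | base => simp
  | succ y hy ih =>
    rw [← Finset.insert_Ico_right_eq_Ico_add_one hy, Finset.sum_insert (by simp), ih]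
    ring

/-- Cauchy–Schwarz along a path, for edge conductances `w`. -/
lemma sq_sub_le_sum_inv_mul_sum (u w : ℤ → ℝ) (hw : ∀ e, 0 < w e) {x y : ℤ} (h : x ≤ y) :
    (u y - u x) ^ 2 ≤ (∑ e ∈ Finset.Ico x y, 1 / w e) *
      ∑ e ∈ Finset.Ico x y, (u (e + 1) - u e) ^ 2 * w e := by
  rw [← sum_Ico_int_sub u h]
  refine Finset.sum_sq_le_sum_mul_sum_of_sq_le_mul _ (fun e _ => (one_div_pos.2 (hw e)).le)
    (fun e _ => mul_nonneg (sq_nonneg _) (hw e).le) fun e _ => le_of_eq ?_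
  have := (hw e).ne'
  field_simp

lemma sum_Ico_le_metroEnergy (u : ℤ → ℝ) {Nm Np x : ℤ} (hx : -Nm ≤ x) :
    ∑ e ∈ Finset.Ico x Np, (u (e + 1) - u e) ^ 2 *
      min (metroF am ap e) (metroF am ap (e + 1)) ≤ metroEnergy am ap Nm Np u := by
  refine Finset.sum_le_sum_of_subset_of_nonneg ?_ fun _ _ _ =>
    mul_nonneg (sq_nonneg _) (min_metroF_pos _).le
  intro e he
  simp only [Finset.mem_Ico, Finset.mem_Icc] at he ⊢
  omega

/-- The resistance of the whole path is the sum of the resistances of its two halves. -/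
lemma sum_resistance (ham : 0 ≤ am) (hap : 0 ≤ ap) (n p : ℕ) :
    ∑ e ∈ Finset.Ico (-(n : ℤ)) p, 1 / min (metroF am ap e) (metroF am ap (e + 1)) =
      ∑ i ∈ Finset.range n, 1 / ((i : ℝ) + 1) ^ am +
        ∑ i ∈ Finset.range p, 1 / ((i : ℝ) + 1) ^ ap := by
  rw [sum_Ico_neg_natCast]
  congr 1
  · exact Finset.sum_congr rfl fun i _ => by rw [min_metroF_neg ham]
  · exact Finset.sum_congr rfl fun i _ => by
      rw [min_metroF_of_nonneg hap (by positivity), Int.cast_natCast]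

lemma sq_sub_le_of_nonneg (hap : 0 ≤ ap) (u : ℤ → ℝ) (n p i : ℕ) (hi : i ≤ p) :
    (u i - u p) ^ 2 * metroF am ap i ≤ p * metroEnergy am ap n p u := by
  have hcs := sq_sub_le_sum_inv_mul_sum u
    (fun e => min (metroF am ap e) (metroF am ap (e + 1))) (fun e => min_metroF_pos e)
    (x := i) (y := p) (by exact_mod_cast hi)
  have hD := sum_Ico_le_metroEnergy (am := am) (ap := ap) u (Nm := n) (Np := p) (x := i) (by omega)
  have hE0 := metroEnergy_nonneg (am := am) (ap := ap) (Nm := n) (Np := p) u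
  have hF := metroF_pos (am := am) (ap := ap) i
  have hR : ∑ e ∈ Finset.Ico (i : ℤ) p, 1 / min (metroF am ap e) (metroF am ap (e + 1)) ≤
      p * (1 / metroF am ap i) := by
    calc _ ≤ ∑ e ∈ Finset.Ico (i : ℤ) p, 1 / metroF am ap i := by
          refine Finset.sum_le_sum fun e he => one_div_le_one_div_of_le hF ?_
          have he' := (Finset.mem_Ico.1 he).1
          rw [min_metroF_of_nonneg hap (by omega), metroF_of_nonneg (by omega)]
          have : ((i : ℤ) : ℝ) ≤ e := by exact_mod_cast he'
          refine Real.rpow_le_rpow ?_ (by linarith) hap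
          push_cast
          positivity
      _ = ((Finset.Ico (i : ℤ) p).card : ℝ) * (1 / metroF am ap i) := by
          rw [Finset.sum_const, nsmul_eq_mul]
      _ ≤ p * (1 / metroF am ap i) := by
          gcongr
          simp
  calc (u i - u p) ^ 2 * metroF am ap i = (u p - u i) ^ 2 * metroF am ap i := by ring
    _ ≤ p * (1 / metroF am ap i) * metroEnergy am ap n p u * metroF am ap i := by
        refine mul_le_mul_of_nonneg_right (hcs.trans ?_) hF.le
        exact mul_le_mul hR hD (Finset.sum_nonneg fun e _ =>
          mul_nonneg (sq_nonneg _) (min_metroF_pos _).le) (by positivity)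
    _ = p * metroEnergy am ap n p u := by field_simp

lemma sq_sub_le_of_neg (ham : 0 ≤ am) (hap : 0 ≤ ap) (u : ℤ → ℝ) (n p i : ℕ) (hi : i < n) :
    (u (-(i : ℤ) - 1) - u p) ^ 2 * metroF am ap (-(i : ℤ) - 1) ≤
      ((n : ℝ) + 1) ^ am * (∑ i ∈ Finset.range n, 1 / ((i : ℝ) + 1) ^ am +
        ∑ i ∈ Finset.range p, 1 / ((i : ℝ) + 1) ^ ap) * metroEnergy am ap n p u := by
  have hcs := sq_sub_le_sum_inv_mul_sum u
    (fun e => min (metroF am ap e) (metroF am ap (e + 1))) (fun e => min_metroF_pos e)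
    (x := -(i : ℤ) - 1) (y := p) (by omega)
  have hD := sum_Ico_le_metroEnergy (am := am) (ap := ap) u (Nm := n) (Np := p)
    (x := -(i : ℤ) - 1) (by omega)
  have hR : ∑ e ∈ Finset.Ico (-(i : ℤ) - 1) p, 1 / min (metroF am ap e) (metroF am ap (e + 1)) ≤
      ∑ e ∈ Finset.Ico (-(n : ℤ)) p, 1 / min (metroF am ap e) (metroF am ap (e + 1)) :=
    Finset.sum_le_sum_of_subset_of_nonneg (Finset.Ico_subset_Ico_left (by omega))
      fun e _ _ => (one_div_pos.2 (min_metroF_pos e)).le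
  have hF : metroF am ap (-(i : ℤ) - 1) ≤ ((n : ℝ) + 1) ^ am := by
    have h : -(i : ℤ) - 1 = -((i + 1 : ℕ) : ℤ) := by push_cast; ring
    rw [h, metroF_neg_natCast]
    have : ((i + 1 : ℕ) : ℝ) ≤ n := by exact_mod_cast hi
    exact Real.rpow_le_rpow (by positivity) (by linarith) ham
  rw [← sum_resistance ham hap]
  have hR0 : 0 ≤ ∑ e ∈ Finset.Ico (-(n : ℤ)) p, 1 / min (metroF am ap e) (metroF am ap (e + 1)) :=
    Finset.sum_nonneg fun e _ => (one_div_pos.2 (min_metroF_pos e)).le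
  have hE0 := metroEnergy_nonneg (am := am) (ap := ap) (Nm := n) (Np := p) u
  calc _ = (u p - u (-(i : ℤ) - 1)) ^ 2 * metroF am ap (-(i : ℤ) - 1) := by ring
    _ ≤ (∑ e ∈ Finset.Ico (-(n : ℤ)) p, 1 / min (metroF am ap e) (metroF am ap (e + 1))) *
        metroEnergy am ap n p u * ((n : ℝ) + 1) ^ am := by
        refine mul_le_mul (hcs.trans ?_) hF (metroF_pos _).le (by positivity)
        exact mul_le_mul hR hD (Finset.sum_nonneg fun e _ =>
          mul_nonneg (sq_nonneg _) (min_metroF_pos _).le) hR0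
    _ = _ := by ring

lemma le_metroGap (ham : 0 ≤ am) (hap : 0 ≤ ap) {n p : ℕ} (hp : 1 ≤ p) {r : ℝ}
    (hr : ∑ i ∈ Finset.range n, 1 / ((i : ℝ) + 1) ^ am +
        ∑ i ∈ Finset.range p, 1 / ((i : ℝ) + 1) ^ ap ≤ r) :
    1 / (2 * ((p + 1) * p + n * ((n : ℝ) + 1) ^ am * r)) ≤ metroGap am ap n p := by
  have hp' : (1 : ℝ) ≤ p := by exact_mod_cast hp
  have hr0 : 0 ≤ r := le_trans (by positivity) hr
  refine le_metroGap_of_poincare (by positivity) (by exact_mod_cast hp) (by positivity)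
    fun u => ⟨u p, ?_⟩
  have hE0 := metroEnergy_nonneg (am := am) (ap := ap) (Nm := n) (Np := p) u
  rw [sum_Icc_neg_natCast]
  have h1 := Finset.sum_le_sum fun i hi =>
    sq_sub_le_of_neg ham hap u n p i (Finset.mem_range.1 hi)
  have h2 := Finset.sum_le_sum fun i hi => sq_sub_le_of_nonneg (am := am) hap u n p i
    (Nat.lt_succ_iff.1 (Finset.mem_range.1 hi))
  rw [Finset.sum_const, Finset.card_range, nsmul_eq_mul] at h1 h2
  refine (add_le_add h1 h2).trans ?_
  have h3 : (n : ℝ) * (((n : ℝ) + 1) ^ am * (∑ i ∈ Finset.range n, 1 / ((i : ℝ) + 1) ^ am +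
        ∑ i ∈ Finset.range p, 1 / ((i : ℝ) + 1) ^ ap) * metroEnergy am ap n p u) ≤
      n * (((n : ℝ) + 1) ^ am * r * metroEnergy am ap n p u) := by gcongr
  refine (add_le_add_left h3 _).trans (le_of_eq ?_)
  push_cast
  ring

end LowerBound

section UpperBound

variable {am ap : ℝ}

lemma le_sum_metroF (hap : 0 ≤ ap) {p : ℕ} (hp : 0 < p) {S : Finset ℤ}
    (hS : ∀ x ∈ S, 0 ≤ x ∧ (p : ℤ) ≤ 4 * (x + 1)) (hcard : p ≤ 4 * S.card) :
    ((p : ℝ) / 4) ^ (1 + ap) ≤ ∑ x ∈ S, metroF am ap x := by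
  have hp' : (0 : ℝ) < p / 4 := by positivity
  have hcard' : (p : ℝ) / 4 ≤ S.card := by
    have : (p : ℝ) ≤ 4 * S.card := by exact_mod_cast hcard
    linarith
  calc ((p : ℝ) / 4) ^ (1 + ap) = p / 4 * ((p : ℝ) / 4) ^ ap := by
        rw [Real.rpow_add hp', Real.rpow_one]
    _ ≤ S.card * ((p : ℝ) / 4) ^ ap := by gcongr
    _ = ∑ x ∈ S, ((p : ℝ) / 4) ^ ap := by rw [Finset.sum_const, nsmul_eq_mul]
    _ ≤ ∑ x ∈ S, metroF am ap x := by
        refine Finset.sum_le_sum fun x hx => ?_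
        obtain ⟨h0, h1⟩ := hS x hx
        rw [metroF_of_nonneg h0]
        have : (p : ℝ) ≤ 4 * (x + 1) := by exact_mod_cast h1
        exact Real.rpow_le_rpow hp'.le (by linarith) hap

lemma le_sum_metroF_Icc (hap : 0 ≤ ap) {p : ℕ} (hp : 0 < p) :
    ((p : ℝ) / 4) ^ (1 + ap) ≤
      ∑ x ∈ Finset.Icc ((3 * (p : ℤ) + 3) / 4) p, metroF am ap x := by
  refine le_sum_metroF hap hp (fun x hx => ?_) ?_
  · simp only [Finset.mem_Icc] at hx
    omega
  · rw [Int.card_Icc]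
    omega

lemma le_sum_metroF_Icc_neg (ham : 0 ≤ am) {n : ℕ} (hn : 0 < n) :
    ((n : ℝ) / 4) ^ (1 + am) ≤
      ∑ x ∈ Finset.Icc (-(n : ℤ)) (-((3 * (n : ℤ) + 3) / 4)), metroF am ap x := by
  rw [sum_Icc_neg_comp, neg_neg]
  simp only [metroF_neg]
  exact le_sum_metroF_Icc ham hn

/-- Upper bound on the gap from the linear test function on one side. -/
lemma metroGap_mul_sq_le (hap : 0 ≤ ap) {n p : ℕ} (hp : 0 < p) :
    metroGap am ap n p * (p : ℝ) ^ 2 ≤ 32 * (4 : ℝ) ^ (1 + ap) := by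
  have hp' : (0 : ℝ) < p := by exact_mod_cast hp
  have hE : metroEnergy am ap n p (fun x => max (x : ℝ) 0) ≤ (p : ℝ) ^ (1 + ap) := by
    unfold metroEnergy
    rw [sum_Icc_neg_natCast_sub_one, Finset.sum_eq_zero, zero_add]
    · calc _ ≤ ∑ i ∈ Finset.range p, (p : ℝ) ^ ap := by
            refine Finset.sum_le_sum fun i hi => ?_
            rw [min_metroF_of_nonneg hap (by positivity)]
            have hi' : (i : ℝ) + 1 ≤ p := by exact_mod_cast Finset.mem_range.1 hi
            have h1 : max (((i : ℤ) + 1 : ℤ) : ℝ) 0 - max ((i : ℤ) : ℝ) 0 = 1 := by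
              rw [max_eq_left (by positivity), max_eq_left (by positivity)]
              push_cast
              ring
            rw [h1, one_pow, one_mul, Int.cast_natCast]
            exact Real.rpow_le_rpow (by positivity) hi' hap
        _ = (p : ℝ) ^ (1 + ap) := by
            rw [Finset.sum_const, Finset.card_range, nsmul_eq_mul, Real.rpow_add hp',
              Real.rpow_one]
    · intro i _
      have h1 : max ((-(i : ℤ) - 1 + 1 : ℤ) : ℝ) 0 = 0 :=
        max_eq_right (by push_cast; linarith [(Nat.cast_nonneg i : (0 : ℝ) ≤ i)])
      have h2 : max ((-(i : ℤ) - 1 : ℤ) : ℝ) 0 = 0 :=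
        max_eq_right (by push_cast; linarith [(Nat.cast_nonneg i : (0 : ℝ) ≤ i)])
      beta_reduce
      rw [h1, h2]
      simp
  have h := metroGap_le_of_separating (am := am) (ap := ap) (Nm := n) (Np := p)
    (S := Finset.Icc (((p : ℤ) + 3) / 4 - 1) ((p : ℤ) / 2))
    (T := Finset.Icc ((3 * (p : ℤ) + 3) / 4) p) (α := (p : ℝ) / 2) (β := 3 * (p : ℝ) / 4)
    (m := ((p : ℝ) / 4) ^ (1 + ap)) (by positivity) (by positivity) ?_ ?_ (by linarith)
    (by positivity) ?_ ?_ ?_ (le_sum_metroF_Icc hap hp) hE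
  · rw [show (3 * (p : ℝ) / 4 - p / 2) = p / 4 by ring,
      Real.div_rpow hp'.le (by norm_num)] at h
    have hP : 0 < (p : ℝ) ^ (1 + ap) := by positivity
    calc _ ≤ 2 * (p : ℝ) ^ (1 + ap) / ((p / 4) ^ 2 * ((p : ℝ) ^ (1 + ap) / 4 ^ (1 + ap))) *
          (p : ℝ) ^ 2 := by gcongr
      _ = 32 * (4 : ℝ) ^ (1 + ap) := by
          field_simp
          norm_num
  · exact Finset.Icc_subset_Icc (by omega) (by omega)
  · exact Finset.Icc_subset_Icc (by omega) le_rfl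
  · intro x hx
    have h1 := (Finset.mem_Icc.1 hx).2
    have h2 : 2 * x ≤ p := by omega
    have h3 : 2 * (x : ℝ) ≤ p := by exact_mod_cast h2
    exact max_le (by linarith) (by positivity)
  · intro x hx
    have h1 := (Finset.mem_Icc.1 hx).1
    have h2 : 3 * (p : ℤ) ≤ 4 * x := by omega
    have h3 : 3 * (p : ℝ) ≤ 4 * x := by exact_mod_cast h2
    exact le_max_of_le_left (by linarith)
  · refine le_sum_metroF hap hp (fun x hx => ?_) ?_
    · simp only [Finset.mem_Icc] at hx
      omega
    · rw [Int.card_Icc]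
      omega

lemma sum_range_one_div_eq_harmonic (n : ℕ) :
    ∑ i ∈ Finset.range n, 1 / ((i : ℝ) + 1) = (harmonic n : ℝ) := by
  unfold harmonic
  push_cast
  simp

/-- Upper bound on the gap from the harmonic test function on the side with exponent `1`. -/
lemma metroGap_one_le (hap : 0 ≤ ap) {n p : ℕ} (hn : 2 ≤ n) (hp : 0 < p) :
    metroGap 1 ap n p ≤ 2 * (1 + Real.log n) /
      ((Real.log n / 2 - 0) ^ 2 * min (((n : ℝ) / 4) ^ (1 + 1 : ℝ)) (((p : ℝ) / 4) ^ (1 + ap))) := by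
  have hn' : (2 : ℝ) ≤ n := by exact_mod_cast hn
  have hp' : (0 : ℝ) < p := by exact_mod_cast hp
  have hlog : 0 < Real.log n := Real.log_pos (by linarith)
  refine metroGap_le_of_separating
    (S := Finset.Icc ((3 * (p : ℤ) + 3) / 4) p)
    (T := Finset.Icc (-(n : ℤ)) (-((3 * (n : ℤ) + 3) / 4)))
    (u := fun x => (harmonic (-x).toNat : ℝ))
    (by positivity) (by positivity) ?_ ?_ (by positivity) (by positivity) ?_ ?_
    ((min_le_right _ _).trans (le_sum_metroF_Icc hap hp))
    ((min_le_left _ _).trans (le_sum_metroF_Icc_neg zero_le_one (by omega))) ?_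
  · exact Finset.Icc_subset_Icc (by omega) le_rfl
  · exact Finset.Icc_subset_Icc le_rfl (by omega)
  · intro x hx
    have h1 := (Finset.mem_Icc.1 hx).1
    have : (-x).toNat = 0 := by omega
    simp [this]
  · intro x hx
    have h1 := (Finset.mem_Icc.1 hx).2
    refine le_trans ?_ (log_add_one_le_harmonic _)
    have h2 : 3 * n ≤ 4 * (-x).toNat := by omega
    set k := (-x).toNat
    have h3 : 3 * (n : ℝ) ≤ 4 * k := by exact_mod_cast h2
    have h4 : Real.log n ≤ Real.log (((k : ℝ) + 1) ^ 2) :=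
      Real.log_le_log (by linarith) (by nlinarith)
    rw [Real.log_pow] at h4
    push_cast at h4 ⊢
    linarith
  · refine le_trans (le_of_eq ?_) (harmonic_le_one_add_log n)
    unfold metroEnergy
    rw [sum_Icc_neg_natCast_sub_one, Finset.sum_eq_zero (s := Finset.range p), add_zero,
      ← sum_range_one_div_eq_harmonic]
    · refine Finset.sum_congr rfl fun i _ => ?_
      have h1 : (-(-(i : ℤ) - 1 + 1)).toNat = i := by omega
      have h2 : (-(-(i : ℤ) - 1)).toNat = i + 1 := by omega
      beta_reduce
      rw [min_metroF_neg zero_le_one, h1, h2, harmonic_succ, Real.rpow_one]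
      push_cast
      field_simp
      ring
    · intro i _
      have h1 : (-((i : ℤ) + 1)).toNat = 0 := by omega
      have h2 : (-(i : ℤ)).toNat = 0 := by omega
      beta_reduce
      rw [h1, h2]
      simp

lemma metroGap_one_mul_log_mul_min_le (hap : 0 ≤ ap) {n p : ℕ} (hn : 2 ≤ n) (hp : 0 < p) :
    metroGap 1 ap n p * (Real.log n * min ((n : ℝ) ^ 2) ((p : ℝ) ^ (1 + ap))) ≤
      (8 + 8 / Real.log 2) * (16 + (4 : ℝ) ^ (1 + ap)) := by
  have hn' : (2 : ℝ) ≤ n := by exact_mod_cast hn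
  have hp' : (0 : ℝ) < p := by exact_mod_cast hp
  have hl2 : 0 < Real.log 2 := Real.log_pos (by norm_num)
  have hlog : Real.log 2 ≤ Real.log n := Real.log_le_log (by norm_num) hn'
  have hln : 0 < Real.log n := hl2.trans_le hlog
  have h4 : (0 : ℝ) < 4 ^ (1 + ap) := by positivity
  set M := min ((n : ℝ) ^ 2) ((p : ℝ) ^ (1 + ap)) with hM
  have hM0 : 0 < M := lt_min (by positivity) (by positivity)
  have hm : M / (16 + 4 ^ (1 + ap)) ≤
      min (((n : ℝ) / 4) ^ (1 + 1 : ℝ)) (((p : ℝ) / 4) ^ (1 + ap)) := by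
    refine le_min ?_ ?_
    · rw [show (1 + 1 : ℝ) = (2 : ℕ) by norm_num, Real.rpow_natCast, div_pow]
      exact div_le_div₀ (by positivity) (min_le_left _ _) (by norm_num) (by linarith)
    · rw [Real.div_rpow hp'.le (by norm_num)]
      exact div_le_div₀ (by positivity) (min_le_right _ _) (by positivity) (by linarith)
  have h1 : 1 + Real.log n ≤ (1 + 1 / Real.log 2) * Real.log n := by
    have : 1 ≤ 1 / Real.log 2 * Real.log n := by
      rw [one_div, inv_mul_eq_div, one_le_div hl2]
      exact hlog
    linarith
  calc _ ≤ 2 * ((1 + 1 / Real.log 2) * Real.log n) /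
        ((Real.log n / 2 - 0) ^ 2 * (M / (16 + 4 ^ (1 + ap)))) * (Real.log n * M) := by
        refine mul_le_mul_of_nonneg_right ((metroGap_one_le hap hn hp).trans ?_) (by positivity)
        rw [sub_zero]
        gcongr
    _ = (8 + 8 / Real.log 2) * (16 + (4 : ℝ) ^ (1 + ap)) := by
        rw [sub_zero]
        field_simp
        ring

end UpperBound

lemma sum_range_one_div_rpow_le {a : ℝ} (ha : 1 < a) (p : ℕ) :
    ∑ i ∈ Finset.range p, 1 / ((i : ℝ) + 1) ^ a ≤ ∑' i : ℕ, 1 / ((i : ℝ) + 1) ^ a := by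
  refine Summable.sum_le_tsum _ (fun i _ => by positivity) ?_
  have h := (summable_nat_add_iff 1).2 (Real.summable_one_div_nat_rpow.2 ha)
  simpa using h

lemma rpow_mul_log_le {a n p : ℝ} (ha : 0 ≤ a) (hn : 1 ≤ n) (hp : 1 ≤ p) :
    p ^ (1 + a) * Real.log n ≤ n ^ 2 + (1 + a) * (p ^ (1 + a) * Real.log p) := by
  have hP : 0 < p ^ (1 + a) := by positivity
  have hlp := Real.log_nonneg hp
  have hln := Real.log_nonneg hn
  rcases le_total (p ^ (1 + a)) n with h | h
  · have h1 : Real.log n ≤ n := Real.log_le_self (by linarith)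
    have h2 : p ^ (1 + a) * Real.log n ≤ n * n := mul_le_mul h h1 hln (by linarith)
    have h3 : 0 ≤ (1 + a) * (p ^ (1 + a) * Real.log p) := by positivity
    nlinarith
  · have h1 := Real.log_le_log (by linarith) h
    rw [Real.log_rpow (by linarith)] at h1
    have h2 := mul_le_mul_of_nonneg_left h1 hP.le
    nlinarith [sq_nonneg n]

lemma lower_scale_left {n p l R κ : ℝ} (hn : 1 ≤ n) (hp : 1 ≤ p) (hl : 0 ≤ l) (hR : 0 ≤ R)
    (hκ : 0 ≤ κ) (h : 1 + R ≤ κ * l) :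
    2 * ((p + 1) * p + n * (n + 1) * (1 + l + R)) ≤ 4 * (1 + κ) * (p ^ 2 + n ^ 2 * l) := by
  have h1 : (p + 1) * p ≤ 2 * p ^ 2 := by nlinarith
  have h2 : n * (n + 1) ≤ 2 * n ^ 2 := by nlinarith
  have h4 : n * (n + 1) * (1 + l + R) ≤ 2 * n ^ 2 * ((1 + κ) * l) :=
    mul_le_mul h2 (by linarith) (by positivity) (by positivity)
  have h6 : 0 ≤ κ * p ^ 2 := by positivity
  linarith

lemma lower_scale_right {n l k R κ a q P T : ℝ} (hn : 1 ≤ n) (hl : 0 ≤ l) (hk : 0 ≤ k)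
    (hR : 0 ≤ R) (hκ : 0 ≤ κ) (h : 1 + R ≤ κ * k) (hq : 0 ≤ q) (ha : 0 ≤ a)
    (hP : 0 ≤ P) (hTP : T ≤ q * P) (hPl : P * l ≤ n ^ 2 + (1 + a) * (P * k)) :
    2 * ((n + 1) * n + T * (1 + l + R)) ≤
      (4 + 2 * q * (κ + (1 + a))) * (n ^ 2 + P * k) := by
  have h1 : (n + 1) * n ≤ 2 * n ^ 2 := by nlinarith
  have h2 : T * (1 + l + R) ≤ q * P * (κ * k + l) :=
    mul_le_mul hTP (by linarith) (by positivity) (by positivity)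
  have h3 := mul_le_mul_of_nonneg_left hPl hq
  have h5 : 0 ≤ q * (κ + a) * n ^ 2 := by positivity
  have h6 : 0 ≤ P * k := by positivity
  linarith

lemma upper_scale {G N M P l k C₁ C₂ C₃ : ℝ} (hG : 0 ≤ G) (hN : 0 < N) (hM : 0 < M)
    (hP : 0 < P) (hl : 0 < l) (hk : 0 < k) (hkl : P ≤ N → k ≤ l) (hC₁ : 0 ≤ C₁) (hC₂ : 0 ≤ C₂)
    (hC₃ : 0 ≤ C₃) (h₁ : G * M ≤ C₁) (h₂ : G * N ≤ C₂) (h₃ : G * (l * min N P) ≤ C₃) :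
    G ≤ (C₁ + C₂ + C₃) * max (1 / (M + N * l)) (1 / (N + P * k)) := by
  rcases le_total N P with h | h
  · rw [min_eq_left h] at h₃
    have h1 : G ≤ (C₁ + C₂ + C₃) * (1 / (M + N * l)) := by
      rw [mul_one_div, le_div_iff₀ (by positivity)]
      linarith
    exact h1.trans (mul_le_mul_of_nonneg_left (le_max_left _ _) (by positivity))
  · rw [min_eq_right h] at h₃
    have h2 : G * (P * k) ≤ G * (l * P) := by
      rw [mul_comm P]
      have := hkl h
      gcongr
    have h1 : G ≤ (C₁ + C₂ + C₃) * (1 / (N + P * k)) := by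
      rw [mul_one_div, le_div_iff₀ (by positivity)]
      linarith
    exact h1.trans (mul_le_mul_of_nonneg_left (le_max_right _ _) (by positivity))

/-- Lemma `lem-2`, fourth case: for `a⁻ = 1 < a⁺` and
`N⁻, N⁺ ≥ 2`, the spectral gap is of order
`max{1/(N⁺² + N⁻² log N⁻), 1/(N⁻² + N⁺^{1+a⁺} log N⁺)}`. -/
theorem gap_asymmetric_critical_mixed (ap : ℝ) (hap : 1 < ap) :
    ∃ c C : ℝ, 0 < c ∧ 0 < C ∧ ∀ Nm Np : ℤ, 2 ≤ Nm → 2 ≤ Np →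
      c * max (1 / ((Np : ℝ) ^ 2 + (Nm : ℝ) ^ 2 * Real.log Nm))
          (1 / ((Nm : ℝ) ^ 2 + (Np : ℝ) ^ (1 + ap) * Real.log Np)) ≤
        metroGap 1 ap Nm Np ∧
      metroGap 1 ap Nm Np ≤
        C * max (1 / ((Np : ℝ) ^ 2 + (Nm : ℝ) ^ 2 * Real.log Nm))
          (1 / ((Nm : ℝ) ^ 2 + (Np : ℝ) ^ (1 + ap) * Real.log Np)) := by
  have hl2 : 0 < Real.log 2 := Real.log_pos (by norm_num)
  have hap0 : 0 ≤ ap := by linarith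
  set R := ∑' i : ℕ, 1 / ((i : ℝ) + 1) ^ ap
  have hR0 : 0 ≤ R := tsum_nonneg fun i => by positivity
  set κ := (1 + R) / Real.log 2 with hκ
  have hκ0 : 0 < κ := by positivity
  set q : ℝ := 2 ^ ap with hq
  have hq0 : 0 < q := by positivity
  set C₁ : ℝ := 32 * 4 ^ (1 + ap)
  set C₂ : ℝ := 32 * 4 ^ (1 + 1 : ℝ)
  set C₃ : ℝ := (8 + 8 / Real.log 2) * (16 + (4 : ℝ) ^ (1 + ap))
  have hC₁0 : 0 < C₁ := by positivity
  have hC₂0 : 0 < C₂ := by positivity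
  have hC₃0 : 0 < C₃ := by positivity
  refine ⟨1 / (4 * (1 + κ) + (4 + 2 * q * (κ + (1 + ap)))), C₁ + C₂ + C₃, by positivity,
    by positivity, ?_⟩
  intro Nm Np hNm hNp
  lift Nm to ℕ using by omega with n
  lift Np to ℕ using by omega with p
  simp only [Int.cast_natCast]
  have hn' : 2 ≤ n := by exact_mod_cast hNm
  have hp' : 2 ≤ p := by exact_mod_cast hNp
  have hn : (2 : ℝ) ≤ n := by exact_mod_cast hn'
  have hp : (2 : ℝ) ≤ p := by exact_mod_cast hp'
  have hsum : ∑ i ∈ Finset.range n, 1 / ((i : ℝ) + 1) ^ (1 : ℝ) +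
      ∑ i ∈ Finset.range p, 1 / ((i : ℝ) + 1) ^ ap ≤ 1 + Real.log n + R := by
    simp only [Real.rpow_one]
    rw [sum_range_one_div_eq_harmonic]
    exact add_le_add (harmonic_le_one_add_log n) (sum_range_one_div_rpow_le hap p)
  have hL := le_metroGap zero_le_one hap0 (by omega) hsum
  have hL' := le_metroGap hap0 zero_le_one (n := p) (p := n) (by omega)
    ((add_comm _ _).trans_le hsum)
  rw [metroGap_symm] at hL'
  have hU := metroGap_mul_sq_le (am := 1) hap0 (n := n) (p := p) (by omega)
  have hU' := metroGap_mul_sq_le (am := ap) zero_le_one (n := p) (p := n) (by omega)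
  rw [metroGap_symm] at hU'
  have hU'' := metroGap_one_mul_log_mul_min_le hap0 hn' (p := p) (by omega)
  have hPlog := rpow_mul_log_le hap0 (by linarith : (1 : ℝ) ≤ n) (by linarith : (1 : ℝ) ≤ p)
  have hpP : (p : ℝ) ^ 2 ≤ (p : ℝ) ^ (1 + ap) := by
    rw [← Real.rpow_natCast]
    exact Real.rpow_le_rpow_of_exponent_le (by linarith) (by push_cast; linarith)
  have hpq : (p : ℝ) * ((p : ℝ) + 1) ^ ap ≤ q * (p : ℝ) ^ (1 + ap) := by
    rw [Real.rpow_add (by linarith), Real.rpow_one]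
    calc (p : ℝ) * ((p : ℝ) + 1) ^ ap ≤ p * (2 * (p : ℝ)) ^ ap := by
          gcongr
          linarith
      _ = q * (p * (p : ℝ) ^ ap) := by
          rw [Real.mul_rpow (by norm_num) (by linarith)]
          ring
  have hlogn : Real.log 2 ≤ Real.log n := Real.log_le_log (by norm_num) hn
  have hlogp : Real.log 2 ≤ Real.log p := Real.log_le_log (by norm_num) hp
  have hκn : 1 + R ≤ κ * Real.log n := by
    rw [hκ, div_mul_eq_mul_div, le_div_iff₀ hl2]
    gcongr
  have hκp : 1 + R ≤ κ * Real.log p := by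
    rw [hκ, div_mul_eq_mul_div, le_div_iff₀ hl2]
    gcongr
  have hlogle : (p : ℝ) ^ (1 + ap) ≤ (n : ℝ) ^ 2 → Real.log p ≤ Real.log n := fun h =>
    Real.log_le_log (by linarith) (abs_le_of_sq_le_sq' (hpP.trans h) (by linarith)).2
  rw [Real.rpow_one] at hL
  have hln0 : 0 < Real.log n := hl2.trans_le hlogn
  have hlp0 : 0 < Real.log p := hl2.trans_le hlogp
  have hn2 : 0 < (n : ℝ) ^ 2 := by positivity
  have hp2 : 0 < (p : ℝ) ^ 2 := by positivity
  have hP0 : 0 < (p : ℝ) ^ (1 + ap) := by positivity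
  have hG0 : 0 ≤ metroGap 1 ap n p := le_trans (by positivity) hL
  constructor
  · rw [mul_max_of_nonneg _ _ (by positivity), one_div_mul_one_div, one_div_mul_one_div]
    have hpos : 0 ≤ 4 + 2 * q * (κ + (1 + ap)) := by positivity
    refine max_le (le_trans (one_div_le_one_div_of_le (by positivity) ?_) hL)
      (le_trans (one_div_le_one_div_of_le (by positivity) ?_) hL')
    · refine (lower_scale_left (by linarith) (by linarith) hln0.le hR0 hκ0.le hκn).trans ?_
      exact mul_le_mul_of_nonneg_right (by linarith) (by positivity)
    · refine (lower_scale_right (by linarith) hln0.le hlp0.le hR0 hκ0.le hκp hq0.le hap0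
        hP0.le hpq hPlog).trans ?_
      exact mul_le_mul_of_nonneg_right (by linarith) (by positivity)
  · exact upper_scale hG0 hn2 hp2 hP0 hln0 hlp0 hlogle hC₁0.le hC₂0.le hC₃0.le hU hU' hU''
end

section
/- Fix C ≥ 1 and δ ∈ (0,1]. There exist constants c₁, C₁ > 0 depending only on C and δ such that the following holds. Let g : [0,1]² → ℝ and 0 < a ≤ A satisfy: (1) |g(z) − g(z′)| ≤ A·‖z − z′‖ for all z, z′ ∈ [0,1]² (Euclidean norm); (2) there exists z₀ ∈ [0,1]² with g(z₀) = 0 and g(z) − g(z + t(z₀ − z)) ≥ a·t·‖z − z₀‖ for all z ∈ [0,1]² and t ∈ [0,1]; (3) A ≤ C·a. Then for every integer N with δ·A ≤ N ≤ a/δ, the normalizing sum satisfies c₁ ≤ Σ_{(x₁,x₂)∈B_N} exp(−g((x₁−1/2)/N, (x₂−1/2)/N)) ≤ C₁, where B_N = {1,…,N}². -/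
open Finset

/-- The two-sided geometric series `k ↦ exp (-c |k|)` on `ℤ` is summable. -/
lemma summable_exp_neg_mul_abs_int {c : ℝ} (hc : 0 < c) :
    Summable (fun k : ℤ => Real.exp (-(c * |(k : ℝ)|))) := by
  have h : Summable (fun n : ℕ => Real.exp (n * (-c))) :=
    Real.summable_exp_nat_mul_iff.mpr (by linarith)
  apply Summable.of_nat_of_neg
  · refine h.congr fun n => ?_
    simp [mul_comm]
  · refine h.congr fun n => ?_
    simp [mul_comm]

/-- A finite sum of `exp (-c |k - w|)` over integers is bounded uniformly in the center `w`. -/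
lemma sum_exp_neg_mul_abs_sub_le {c : ℝ} (hc : 0 < c) (s : Finset ℤ) (w : ℝ) :
    ∑ k ∈ s, Real.exp (-(c * |(k : ℝ) - w|)) ≤
      Real.exp c * ∑' k : ℤ, Real.exp (-(c * |(k : ℝ)|)) := by
  have hS := summable_exp_neg_mul_abs_int hc
  have hS' := (Equiv.subRight ⌊w⌋).summable_iff.mpr hS
  calc ∑ k ∈ s, Real.exp (-(c * |(k : ℝ) - w|))
      ≤ ∑ k ∈ s, Real.exp c * Real.exp (-(c * |((k - ⌊w⌋ : ℤ) : ℝ)|)) := by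
        refine Finset.sum_le_sum fun k _ => ?_
        rw [← Real.exp_add, Real.exp_le_exp]
        have h1 := Int.floor_le w
        have h2 := Int.lt_floor_add_one w
        have h3 : |(k : ℝ) - ⌊w⌋| ≤ |(k : ℝ) - w| + 1 := by
          calc |(k : ℝ) - ⌊w⌋| ≤ |(k : ℝ) - w| + |w - ⌊w⌋| := abs_sub_le _ _ _
            _ ≤ _ := by
              gcongr
              rw [abs_le]
              constructor <;> linarith
        push_cast
        nlinarith
    _ = Real.exp c * ∑ k ∈ s, Real.exp (-(c * |((k - ⌊w⌋ : ℤ) : ℝ)|)) := by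
        rw [Finset.mul_sum]
    _ ≤ Real.exp c * ∑' k : ℤ, Real.exp (-(c * |((k - ⌊w⌋ : ℤ) : ℝ)|)) := by
        gcongr
        exact hS'.sum_le_tsum s fun k _ => (Real.exp_pos _).le
    _ = _ := by
        congr 1
        exact (Equiv.subRight ⌊w⌋).tsum_eq (fun k : ℤ => Real.exp (-(c * |(k : ℝ)|)))

/-- Every point of `[0, 1]` lies within `1 / N` of one of the midpoints `(k - 1/2) / N`. -/
lemma exists_midpoint_near {N : ℤ} (hN : 1 ≤ N) {u : ℝ} (hu0 : 0 ≤ u) (hu1 : u ≤ 1) :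
    ∃ k ∈ Finset.Icc 1 N, |((k : ℝ) - 1 / 2) / N - u| ≤ 1 / N := by
  have hNR : (1 : ℝ) ≤ N := by exact_mod_cast hN
  have hpos : (0 : ℝ) < N := by linarith
  suffices h : ∃ k ∈ Finset.Icc 1 N, |(k : ℝ) - 1 / 2 - N * u| ≤ 1 by
    obtain ⟨k, hk, h⟩ := h
    refine ⟨k, hk, ?_⟩
    have e : ((k : ℝ) - 1 / 2) / N - u = ((k : ℝ) - 1 / 2 - N * u) / N := by field_simp
    rw [e, abs_div, abs_of_pos hpos]
    gcongr
  rcases hu0.eq_or_lt with rfl | hu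
  · exact ⟨1, by simp [hN], by norm_num [abs_le]⟩
  · refine ⟨⌈N * u⌉, ?_, ?_⟩
    · rw [Finset.mem_Icc]
      exact ⟨Int.one_le_ceil_iff.mpr (by positivity), Int.ceil_le.mpr (by nlinarith)⟩
    · have h1 := Int.le_ceil (N * u)
      have h2 := Int.ceil_lt_add_one (N * u)
      rw [abs_le]
      constructor <;> linarith

/-- The midpoints `(k - 1/2) / N` lie in the unit interval. -/
lemma midpoint_mem_unit {N k : ℤ} (hk : k ∈ Finset.Icc 1 N) :
    0 ≤ ((k : ℝ) - 1 / 2) / N ∧ ((k : ℝ) - 1 / 2) / N ≤ 1 := by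
  rw [Finset.mem_Icc] at hk
  have h1 : (1 : ℝ) ≤ k := by exact_mod_cast hk.1
  have h2 : (k : ℝ) ≤ N := by exact_mod_cast hk.2
  exact ⟨div_nonneg (by linarith) (by linarith), (div_le_one (by linarith)).mpr (by linarith)⟩

lemma abs_add_abs_le_two_mul_sqrt (x y : ℝ) : |x| + |y| ≤ 2 * Real.sqrt (x ^ 2 + y ^ 2) := by
  have h1 : |x| ≤ Real.sqrt (x ^ 2 + y ^ 2) := Real.abs_le_sqrt (by nlinarith)
  have h2 : |y| ≤ Real.sqrt (x ^ 2 + y ^ 2) := Real.abs_le_sqrt (by nlinarith)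
  linarith

lemma sqrt_sq_add_sq_le_abs_add_abs (x y : ℝ) : Real.sqrt (x ^ 2 + y ^ 2) ≤ |x| + |y| := by
  rw [Real.sqrt_le_left (by positivity)]
  nlinarith [sq_abs x, sq_abs y, mul_nonneg (abs_nonneg x) (abs_nonneg y)]

/-- under the exponential fall-off hypotheses of Proposition
`pro-exp2`, the normalizing sum `Σ_{B_N} F_N` is bounded above and below by
constants depending only on `C` and `δ`. -/
theorem normalizing_sum_exponential_falloff
    (C : ℝ) (hC : 1 ≤ C) (δ : ℝ) (hδ0 : 0 < δ) (hδ1 : δ ≤ 1) :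
    ∃ c₁ C₁ : ℝ, 0 < c₁ ∧ 0 < C₁ ∧
    ∀ (g : ℝ × ℝ → ℝ) (a A : ℝ), 0 < a → a ≤ A →
      (∀ z ∈ Set.Icc ((0 : ℝ), (0 : ℝ)) (1, 1), ∀ z' ∈ Set.Icc ((0 : ℝ), (0 : ℝ)) (1, 1),
        |g z - g z'| ≤ A * Real.sqrt ((z.1 - z'.1) ^ 2 + (z.2 - z'.2) ^ 2)) →
      (∃ z₀ ∈ Set.Icc ((0 : ℝ), (0 : ℝ)) (1, 1), g z₀ = 0 ∧
        ∀ z ∈ Set.Icc ((0 : ℝ), (0 : ℝ)) (1, 1), ∀ t ∈ Set.Icc (0 : ℝ) 1,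
          g z - g (z.1 + t * (z₀.1 - z.1), z.2 + t * (z₀.2 - z.2)) ≥
            a * t * Real.sqrt ((z.1 - z₀.1) ^ 2 + (z.2 - z₀.2) ^ 2)) →
      A ≤ C * a →
      ∀ N : ℤ, δ * A ≤ (N : ℝ) → (N : ℝ) ≤ a / δ →
        c₁ ≤ (∑ x ∈ Finset.Icc 1 N ×ˢ Finset.Icc 1 N,
            Real.exp (-g (((x.1 : ℝ) - 1 / 2) / (N : ℝ), ((x.2 : ℝ) - 1 / 2) / (N : ℝ)))) ∧
        (∑ x ∈ Finset.Icc 1 N ×ˢ Finset.Icc 1 N,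
            Real.exp (-g (((x.1 : ℝ) - 1 / 2) / (N : ℝ), ((x.2 : ℝ) - 1 / 2) / (N : ℝ)))) ≤ C₁ := by
  have hc : 0 < δ / 2 := by positivity
  set K := Real.exp (δ / 2) * ∑' k : ℤ, Real.exp (-(δ / 2 * |(k : ℝ)|))
  have hKpos : 0 < K := by
    refine mul_pos (Real.exp_pos _) ?_
    exact (summable_exp_neg_mul_abs_int hc).tsum_pos (fun k => (Real.exp_pos _).le) 0
      (Real.exp_pos _)
  refine ⟨Real.exp (-(2 / δ)), K * K, Real.exp_pos _, mul_pos hKpos hKpos, ?_⟩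
  rintro g a A ha haA hlip ⟨⟨u, v⟩, hz₀, hg0, hfall⟩ - N hNA hNa
  have hA : 0 < A := ha.trans_le haA
  have hNR : (0 : ℝ) < N := (mul_pos hδ0 hA).trans_le hNA
  have hN : 1 ≤ N := by
    have : 0 < N := by exact_mod_cast hNR
    omega
  have huv := hz₀
  simp only [Set.mem_Icc, Prod.mk_le_mk] at huv
  obtain ⟨⟨hu0, hv0⟩, hu1, hv1⟩ := huv
  have hmem : ∀ x ∈ Finset.Icc 1 N ×ˢ Finset.Icc 1 N,
      (((x.1 : ℝ) - 1 / 2) / (N : ℝ), ((x.2 : ℝ) - 1 / 2) / (N : ℝ)) ∈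
        Set.Icc ((0 : ℝ), (0 : ℝ)) (1, 1) := by
    intro x hx
    rw [Finset.mem_product] at hx
    have h1 := midpoint_mem_unit hx.1
    have h2 := midpoint_mem_unit hx.2
    exact ⟨⟨h1.1, h2.1⟩, h1.2, h2.2⟩
  constructor
  · obtain ⟨k, hk, hku⟩ := exists_midpoint_near hN hu0 hu1
    obtain ⟨l, hl, hlv⟩ := exists_midpoint_near hN hv0 hv1
    have hkl : (k, l) ∈ Finset.Icc 1 N ×ˢ Finset.Icc 1 N := Finset.mem_product.mpr ⟨hk, hl⟩
    refine le_trans ?_ (Finset.single_le_sum (fun x _ => (Real.exp_pos _).le) hkl)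
    rw [Real.exp_le_exp, neg_le_neg_iff]
    have h := hlip _ (hmem _ hkl) _ hz₀
    rw [hg0, sub_zero] at h
    refine (le_abs_self _).trans (h.trans ?_)
    calc _ ≤ A * (1 / N + 1 / N) := by
          gcongr
          exact (sqrt_sq_add_sq_le_abs_add_abs _ _).trans (add_le_add hku hlv)
      _ ≤ 2 / δ := by
          rw [← add_div, mul_div_assoc', div_le_div_iff₀ hNR hδ0]
          linarith
  · have hterm : ∀ x ∈ Finset.Icc 1 N ×ˢ Finset.Icc 1 N,
        Real.exp (-g (((x.1 : ℝ) - 1 / 2) / (N : ℝ), ((x.2 : ℝ) - 1 / 2) / (N : ℝ))) ≤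
          Real.exp (-(δ / 2 * |(x.1 : ℝ) - (N * u + 1 / 2)|)) *
            Real.exp (-(δ / 2 * |(x.2 : ℝ) - (N * v + 1 / 2)|)) := by
      intro x hx
      rw [← Real.exp_add, Real.exp_le_exp]
      have h := hfall _ (hmem x hx) 1 (by simp)
      simp only [one_mul, mul_one, add_sub_cancel, hg0, sub_zero] at h
      have hs := abs_add_abs_le_two_mul_sqrt (((x.1 : ℝ) - 1 / 2) / N - u)
        (((x.2 : ℝ) - 1 / 2) / N - v)
      have hscale : ∀ p q : ℝ, |p - (N * q + 1 / 2)| = N * |(p - 1 / 2) / N - q| := by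
        intro p q
        rw [← abs_of_pos hNR, ← abs_mul, abs_of_pos hNR]
        congr 1
        field_simp
        ring
      rw [hscale, hscale]
      have hδN : N * δ ≤ a := (le_div_iff₀ hδ0).mp hNa
      set S := Real.sqrt ((((x.1 : ℝ) - 1 / 2) / N - u) ^ 2 + (((x.2 : ℝ) - 1 / 2) / N - v) ^ 2)
      have h1 : N * δ * S ≤ a * S := mul_le_mul_of_nonneg_right hδN (Real.sqrt_nonneg _)
      have h2 := mul_le_mul_of_nonneg_left hs (by positivity : (0 : ℝ) ≤ N * δ / 2)
      linarith
    refine (Finset.sum_le_sum hterm).trans ?_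
    rw [Finset.sum_product]
    dsimp only
    rw [← Finset.sum_mul_sum]
    exact mul_le_mul (sum_exp_neg_mul_abs_sub_le hc _ _) (sum_exp_neg_mul_abs_sub_le hc _ _)
      (Finset.sum_nonneg fun _ _ => (Real.exp_pos _).le) hKpos.le
end

section
/- Fix α = 1 and ε ∈ (0,1]. There exist constants c, C > 0 depending only on ε such that for all reals a, b with a² + b² = 1, all reals A > 0, and all integers N ≥ 2 with εA ≤ N ≤ A/ε, the spectral gap λ of the Metropolis chain on 𝓑_N = {−N+1,…,N}² for the probability measure π proportional to F_N(x₁,x₂) = 1 + A·|a·(x₁−1/2)/N + b·(x₂−1/2)/N| satisfies c/(N² log N) ≤ λ ≤ C/(N² log N). -/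
open Finset

/-- The probability measure on a finite box in `ℤ²` proportional to `F`. -/
noncomputable def metroPi2 (box : Finset (ℤ × ℤ)) (F : ℤ × ℤ → ℝ) (k : ℤ × ℤ) : ℝ :=
  F k / ∑ l ∈ box, F l

/-- Dirichlet form of the Metropolis chain for the measure proportional to `F`
based on simple random walk: sum over unordered nearest-neighbor pairs of
`(u(k)-u(l))²·(1/4)·min{π(k),π(l)}`. -/
noncomputable def metroDirichlet2 (box : Finset (ℤ × ℤ)) (F : ℤ × ℤ → ℝ)
    (u : ℤ × ℤ → ℝ) : ℝ :=
  (∑ k ∈ box,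
    if (k.1 + 1, k.2) ∈ box then
      (u (k.1 + 1, k.2) - u k) ^ 2 *
        (1 / 4 * min (metroPi2 box F k) (metroPi2 box F (k.1 + 1, k.2)))
    else 0) +
  ∑ k ∈ box,
    if (k.1, k.2 + 1) ∈ box then
      (u (k.1, k.2 + 1) - u k) ^ 2 *
        (1 / 4 * min (metroPi2 box F k) (metroPi2 box F (k.1, k.2 + 1)))
    else 0

/-- Variance with respect to the measure proportional to `F`. -/
noncomputable def metroVar2 (box : Finset (ℤ × ℤ)) (F : ℤ × ℤ → ℝ)
    (u : ℤ × ℤ → ℝ) : ℝ :=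
  ∑ k ∈ box,
    (u k - ∑ l ∈ box, u l * metroPi2 box F l) ^ 2 * metroPi2 box F k

/-- Spectral gap of the Metropolis chain:
`λ = inf { ℰ(u,u)/Var_π(u) : Var_π(u) ≠ 0 }`. -/
noncomputable def metroGap2 (box : Finset (ℤ × ℤ)) (F : ℤ × ℤ → ℝ) : ℝ :=
  sInf {r : ℝ | ∃ u : ℤ × ℤ → ℝ, metroVar2 box F u ≠ 0 ∧
    r = metroDirichlet2 box F u / metroVar2 box F u}

/-- The horizontal edge energy of `u` on `{-N+1,…,N}²`, with edge weights `min (F k) (F l)`. -/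
noncomputable def horizontalEnergy (N : ℤ) (F u : ℤ × ℤ → ℝ) : ℝ :=
  ∑ y ∈ Icc (-N + 1) N, ∑ x ∈ Ico (-N + 1) N,
    min (F (x, y)) (F (x + 1, y)) * (u (x + 1, y) - u (x, y)) ^ 2

/-- The signed distance from `k - (1/2, 1/2)` to the line `a z₁ + b z₂ = 0`. -/
noncomputable def lineDist (a b : ℝ) (k : ℤ × ℤ) : ℝ :=
  a * ((k.1 : ℝ) - 1 / 2) + b * ((k.2 : ℝ) - 1 / 2)

lemma sum_Ico_succ_sub (f : ℤ → ℝ) {x z : ℤ} (h : x ≤ z) :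
    ∑ t ∈ Ico x z, (f (t + 1) - f t) = f z - f x := by
  induction z, h using Int.leInduction with
  | base => simp
  | succ z hz ih =>
    have : Ico x (z + 1) = insert z (Ico x z) := by
      ext t; simp only [mem_Ico, mem_insert]; omega
    rw [this, sum_insert (by simp), ih]; ring

lemma sq_sub_le_of_path {m M x z : ℤ} (f c : ℤ → ℝ) (hc : ∀ t, 0 < c t)
    (hx : x ∈ Icc m M) (hz : z ∈ Icc m M) :
    (f x - f z) ^ 2 ≤
      (∑ t ∈ Ico m M, 1 / c t) * ∑ t ∈ Ico m M, c t * (f (t + 1) - f t) ^ 2 := by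
  wlog h : x ≤ z generalizing x z
  · have := this hz hx (by omega)
    nlinarith
  rw [mem_Icc] at hx hz
  have hsub : Ico x z ⊆ Ico m M := Ico_subset_Ico hx.1 hz.2
  have h1 : (f x - f z) ^ 2 ≤
      (∑ t ∈ Ico x z, 1 / c t) * ∑ t ∈ Ico x z, c t * (f (t + 1) - f t) ^ 2 := by
    have := sum_sq_le_sum_mul_sum_of_sq_le_mul (Ico x z) (r := fun t => f (t + 1) - f t)
      (f := fun t => 1 / c t) (g := fun t => c t * (f (t + 1) - f t) ^ 2)
      (fun t _ => (one_div_pos.2 (hc t)).le)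
      (fun t _ => mul_nonneg (hc t).le (sq_nonneg _))
      (fun t _ => le_of_eq (by have := (hc t).ne'; field_simp))
    rw [sum_Ico_succ_sub f h] at this
    linarith [this, (by ring : (f z - f x) ^ 2 = (f x - f z) ^ 2)]
  refine h1.trans (mul_le_mul ?_ ?_ ?_ ?_)
  · exact sum_le_sum_of_subset_of_nonneg hsub fun t _ _ => (one_div_pos.2 (hc t)).le
  · exact sum_le_sum_of_subset_of_nonneg hsub fun t _ _ => mul_nonneg (hc t).le (sq_nonneg _)
  · exact sum_nonneg fun t _ => mul_nonneg (hc t).le (sq_nonneg _)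
  · exact sum_nonneg fun t _ => (one_div_pos.2 (hc t)).le

lemma horizontalEnergy_nonneg (N : ℤ) (F u : ℤ × ℤ → ℝ) (hF : ∀ k, 0 < F k) :
    0 ≤ horizontalEnergy N F u :=
  sum_nonneg fun _ _ => sum_nonneg fun _ _ =>
    mul_nonneg (lt_min (hF _) (hF _)).le (sq_nonneg _)

lemma card_Icc_box (N : ℤ) (hN : 2 ≤ N) : ((#(Icc (-N + 1) N) : ℕ) : ℝ) = 2 * N := by
  have : ((#(Icc (-N + 1) N) : ℕ) : ℤ) = 2 * N := by simp; omega
  exact_mod_cast this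

/-- A weighted Poincaré inequality by canonical paths: a horizontal, a vertical and again a
horizontal segment, the vertical one being averaged over the columns close to the right side. -/
lemma sum_sum_sq_sub_le (N : ℤ) (hN : 2 ≤ N) (F u : ℤ × ℤ → ℝ) (hF : ∀ k, 0 < F k) (B L : ℝ)
    (hB : ∀ k ∈ Icc (-N + 1) N ×ˢ Icc (-N + 1) N, F k ≤ B * N)
    (hrow : ∀ y ∈ Icc (-N + 1) N,
      ∑ x ∈ Ico (-N + 1) N, 1 / min (F (x, y)) (F (x + 1, y)) ≤ L)
    (hcol : ∀ x ∈ Icc (N - N / 8) N,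
      ∑ y ∈ Ico (-N + 1) N, 1 / min (F (x, y)) (F (x, y + 1)) ≤ L) :
    ∑ k ∈ Icc (-N + 1) N ×ˢ Icc (-N + 1) N, ∑ l ∈ Icc (-N + 1) N ×ˢ Icc (-N + 1) N,
      F k * F l * (u k - u l) ^ 2 ≤
    96 * L * B * N ^ 2 * (∑ k ∈ Icc (-N + 1) N ×ˢ Icc (-N + 1) N, F k) *
      (horizontalEnergy N F u + horizontalEnergy N (F ∘ Prod.swap) (u ∘ Prod.swap)) := by
  set I := Icc (-N + 1) N with hI
  set S := Icc (N - N / 8) N with hS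
  have hNR : (2 : ℝ) ≤ N := by exact_mod_cast hN
  have hSI : S ⊆ I := Icc_subset_Icc (by omega) le_rfl
  have hScard : (N : ℝ) / 8 ≤ #S := by
    have h : N ≤ 8 * ((#S : ℕ) : ℤ) := by rw [hS, Int.card_Icc]; omega
    have h' : (N : ℝ) ≤ 8 * (#S : ℕ) := by exact_mod_cast h
    linarith
  set R : ℤ → ℝ := fun y => ∑ x ∈ Ico (-N + 1) N,
    min (F (x, y)) (F (x + 1, y)) * (u (x + 1, y) - u (x, y)) ^ 2 with hR
  set V : ℤ → ℝ := fun x => ∑ y ∈ Ico (-N + 1) N,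
    min (F (x, y)) (F (x, y + 1)) * (u (x, y + 1) - u (x, y)) ^ 2 with hV
  have hR0 : ∀ y, 0 ≤ R y := fun y => sum_nonneg fun _ _ =>
    mul_nonneg (lt_min (hF _) (hF _)).le (sq_nonneg _)
  have hV0 : ∀ y, 0 ≤ V y := fun y => sum_nonneg fun _ _ =>
    mul_nonneg (lt_min (hF _) (hF _)).le (sq_nonneg _)
  have hEh : horizontalEnergy N F u = ∑ y ∈ I, R y := rfl
  have hEv : horizontalEnergy N (F ∘ Prod.swap) (u ∘ Prod.swap) = ∑ x ∈ I, V x := rfl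
  rw [hEh, hEv]
  set EV := ∑ x ∈ I, V x with hEV
  set Z := ∑ k ∈ I ×ˢ I, F k with hZ
  have hI1 : (1 : ℤ) ∈ I := by rw [hI, mem_Icc]; omega
  have hNS : N ∈ S := by rw [hS, mem_Icc]; omega
  have hL : 0 ≤ L := le_trans (sum_nonneg fun x _ =>
    (one_div_pos.2 (lt_min (hF _) (hF _))).le) (hrow 1 hI1)
  have hEV0 : 0 ≤ EV := sum_nonneg fun x _ => hV0 x
  have hER0 : 0 ≤ ∑ y ∈ I, R y := sum_nonneg fun x _ => hR0 x
  have hcard := card_Icc_box N hN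
  rw [← hI] at hcard
  have hB0 : 0 < B := by
    have h1 := hB (1, 1) (mk_mem_product hI1 hI1)
    have h2 := hF (1, 1)
    by_contra hneg
    nlinarith
  have hZ0 : 0 ≤ Z := sum_nonneg fun k _ => (hF k).le
  have hZB : Z ≤ 4 * B * N ^ 3 := by
    have := sum_le_card_nsmul (I ×ˢ I) F (B * N) hB
    rw [card_product, nsmul_eq_mul, Nat.cast_mul, hcard] at this
    linarith [this, (by ring : 2 * (N : ℝ) * (2 * N) * (B * N) = 4 * B * N ^ 3)]
  have hpt : ∀ k ∈ I ×ˢ I, ∀ l ∈ I ×ˢ I,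
      (u k - u l) ^ 2 ≤ 3 * L * (R k.2 + R l.2 + 8 / N * EV) := by
    rintro ⟨x, y⟩ hk ⟨x', y'⟩ hl
    rw [mem_product] at hk hl
    have hz : ∀ z ∈ S, (u (x, y) - u (x', y')) ^ 2 ≤ 3 * L * (R y + R y') + 3 * L * V z := by
      intro z hz
      have h1 := sq_sub_le_of_path (fun t => u (t, y)) (fun t => min (F (t, y)) (F (t + 1, y)))
        (fun t => lt_min (hF _) (hF _)) hk.1 (hSI hz)
      have h2 := sq_sub_le_of_path (fun t => u (t, y')) (fun t => min (F (t, y')) (F (t + 1, y')))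
        (fun t => lt_min (hF _) (hF _)) (hSI hz) hl.1
      have h3 := sq_sub_le_of_path (fun t => u (z, t)) (fun t => min (F (z, t)) (F (z, t + 1)))
        (fun t => lt_min (hF _) (hF _)) hk.2 hl.2
      have h1' := h1.trans (mul_le_mul_of_nonneg_right (hrow y hk.2) (hR0 y))
      have h2' := h2.trans (mul_le_mul_of_nonneg_right (hrow y' hl.2) (hR0 y'))
      have h3' := h3.trans (mul_le_mul_of_nonneg_right (hcol z hz) (hV0 z))
      change _ ≤ L * R y at h1'
      change _ ≤ L * R y' at h2'
      change _ ≤ L * V z at h3'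
      simp only at h1' h2' h3'
      nlinarith [sq_nonneg ((u (x, y) - u (z, y)) - (u (z, y) - u (z, y'))),
        sq_nonneg ((u (x, y) - u (z, y)) - (u (z, y') - u (x', y'))),
        sq_nonneg ((u (z, y) - u (z, y')) - (u (z, y') - u (x', y')))]
    have hsum := sum_le_sum hz
    rw [sum_add_distrib, sum_const, sum_const, nsmul_eq_mul, nsmul_eq_mul, ← mul_sum] at hsum
    have hVS : ∑ z ∈ S, V z ≤ EV := sum_le_sum_of_subset_of_nonneg hSI fun z _ _ => hV0 z
    have hS0 : (0 : ℝ) < #S := lt_of_lt_of_le (by positivity) hScard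
    have hE8 : EV ≤ (#S : ℝ) * (8 / N * EV) := by
      have : 1 ≤ (#S : ℝ) * (8 / N) := by
        rw [mul_div_assoc', le_div_iff₀ (by positivity)]; linarith
      nlinarith
    have : 3 * L * ∑ z ∈ S, V z ≤ 3 * L * ((#S : ℝ) * (8 / N * EV)) :=
      mul_le_mul_of_nonneg_left (hVS.trans hE8) (by positivity)
    refine le_of_mul_le_mul_left ?_ hS0
    simp only
    linarith
  have hRF : ∑ k ∈ I ×ˢ I, F k * R k.2 ≤ 2 * B * N ^ 2 * ∑ y ∈ I, R y := by
    calc ∑ k ∈ I ×ˢ I, F k * R k.2 ≤ ∑ k ∈ I ×ˢ I, B * N * R k.2 :=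
          sum_le_sum fun k hk => mul_le_mul_of_nonneg_right (hB k hk) (hR0 _)
      _ = 2 * B * N ^ 2 * ∑ y ∈ I, R y := by
          rw [sum_product]
          simp only
          rw [sum_const, nsmul_eq_mul, hcard, ← mul_sum]; ring
  calc ∑ k ∈ I ×ˢ I, ∑ l ∈ I ×ˢ I, F k * F l * (u k - u l) ^ 2
      ≤ ∑ k ∈ I ×ˢ I, ∑ l ∈ I ×ˢ I, F k * F l * (3 * L * (R k.2 + R l.2 + 8 / N * EV)) :=
        sum_le_sum fun k hk => sum_le_sum fun l hl =>
          mul_le_mul_of_nonneg_left (hpt k hk l hl) (mul_pos (hF k) (hF l)).le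
    _ = 3 * L * Z * (2 * (∑ k ∈ I ×ˢ I, F k * R k.2) + 8 / N * EV * Z) := by
        have h1 : ∀ k ∈ I ×ˢ I,
            ∑ l ∈ I ×ˢ I, F k * F l * (3 * L * (R k.2 + R l.2 + 8 / N * EV)) =
            3 * L * Z * (F k * R k.2) + 3 * L * (∑ l ∈ I ×ˢ I, F l * R l.2) * F k +
              3 * L * (8 / N * EV) * Z * F k := by
          intro k _
          rw [hZ]
          simp only [mul_sum, sum_mul, ← sum_add_distrib]
          exact sum_congr rfl fun l _ => by ring
        rw [sum_congr rfl h1, sum_add_distrib, sum_add_distrib, ← mul_sum, ← mul_sum, ← mul_sum,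
          ← hZ]
        ring
    _ ≤ 3 * L * Z * (2 * (2 * B * N ^ 2 * ∑ y ∈ I, R y) + 32 * B * N ^ 2 * EV) := by
        refine mul_le_mul_of_nonneg_left ?_ (by positivity)
        have : 8 / N * EV * Z ≤ 32 * B * N ^ 2 * EV := by
          calc 8 / N * EV * Z ≤ 8 / N * EV * (4 * B * N ^ 3) :=
                mul_le_mul_of_nonneg_left hZB (by positivity)
            _ = 32 * B * N ^ 2 * EV := by field_simp; ring
        linarith
    _ ≤ 96 * L * B * N ^ 2 * Z * (∑ y ∈ I, R y + EV) := by
        have h : 0 ≤ L * Z * B * N ^ 2 * ∑ y ∈ I, R y := by positivity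
        linarith

lemma exists_arsinh_add_sub_arsinh (s δ : ℝ) :
    ∃ ξ : ℝ, |ξ - s| ≤ |δ| ∧
      Real.arsinh (s + δ) - Real.arsinh s = δ * (√(1 + ξ ^ 2))⁻¹ := by
  rcases lt_trichotomy δ 0 with h | rfl | h
  · obtain ⟨ξ, hξ, he⟩ := exists_hasDerivAt_eq_slope Real.arsinh _ (by linarith : s + δ < s)
      Real.continuous_arsinh.continuousOn (fun x _ => Real.hasDerivAt_arsinh x)
    refine ⟨ξ, ?_, ?_⟩
    · rw [abs_of_neg h, abs_le]; constructor <;> linarith [hξ.1, hξ.2]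
    · rw [he]
      have : s - (s + δ) ≠ 0 := by intro h0; linarith
      field_simp
      ring
  · exact ⟨s, by simp⟩
  · obtain ⟨ξ, hξ, he⟩ := exists_hasDerivAt_eq_slope Real.arsinh _ (by linarith : s < s + δ)
      Real.continuous_arsinh.continuousOn (fun x _ => Real.hasDerivAt_arsinh x)
    refine ⟨ξ, ?_, ?_⟩
    · rw [abs_of_pos h, abs_le]; constructor <;> linarith [hξ.1, hξ.2]
    · rw [he]
      have : s + δ - s ≠ 0 := by intro h0; linarith
      field_simp
      ring

lemma sq_arsinh_add_sub_arsinh_le (s δ : ℝ) (hδ : |δ| ≤ 1) :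
    (Real.arsinh (s + δ) - Real.arsinh s) ^ 2 ≤ 9 / (1 + |s|) ^ 2 := by
  obtain ⟨ξ, hξ, he⟩ := exists_arsinh_add_sub_arsinh s δ
  rw [he, mul_pow, inv_pow, Real.sq_sqrt (by positivity), ← div_eq_mul_inv,
    div_le_div_iff₀ (by positivity) (by positivity)]
  have h1 : |s| ≤ |ξ| + 1 := by
    have := abs_sub_abs_le_abs_sub s ξ
    rw [abs_sub_comm] at this
    linarith
  have h2 : δ ^ 2 ≤ 1 := by rw [← sq_abs]; nlinarith [abs_nonneg δ]
  have h3 : (1 + |s|) ^ 2 ≤ 9 * (1 + ξ ^ 2) := by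
    rw [← sq_abs ξ]
    nlinarith [abs_nonneg s, abs_nonneg ξ, sq_nonneg (|ξ| - 1)]
  nlinarith [sq_nonneg (1 + |s|)]

lemma one_div_le_arsinh_sub (s α : ℝ) (h1 : 1 / 3 ≤ α) (h2 : α ≤ 1) :
    1 / (1 + |s|) ≤ 6 * (Real.arsinh (s + α) - Real.arsinh s) := by
  obtain ⟨ξ, hξ, he⟩ := exists_arsinh_add_sub_arsinh s α
  have h3 : |ξ| ≤ |s| + 1 := by
    have := abs_sub_abs_le_abs_sub ξ s
    rw [abs_of_nonneg (by linarith : 0 ≤ α)] at hξ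
    linarith
  have h4 : √(1 + ξ ^ 2) ≤ 2 * (1 + |s|) := by
    rw [Real.sqrt_le_left (by positivity), ← sq_abs ξ]
    nlinarith [abs_nonneg s, abs_nonneg ξ]
  have h5 : 0 < √(1 + ξ ^ 2) := Real.sqrt_pos.2 (by positivity)
  rw [he, ← div_eq_mul_inv, mul_div_assoc', div_le_div_iff₀ (by positivity) h5]
  nlinarith [abs_nonneg s]

lemma abs_arsinh_le (N s : ℝ) (hN : 2 ≤ N) (hs : |s| ≤ 3 * N) :
    |Real.arsinh s| ≤ 4 * Real.log N := by
  have key : ∀ t : ℝ, t ≤ 3 * N → Real.arsinh t ≤ 4 * Real.log N := by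
    intro t ht
    refine (Real.arsinh_le_arsinh.2 ht).trans ?_
    have h1 : √(1 + (3 * N) ^ 2) ≤ 1 + 3 * N := by
      rw [Real.sqrt_le_left (by positivity)]; nlinarith
    have h2 : 0 < 3 * N + √(1 + (3 * N) ^ 2) := by positivity
    rw [Real.arsinh, show 4 * Real.log N = Real.log (N ^ 4) by rw [Real.log_pow]; norm_num]
    refine Real.log_le_log h2 ?_
    have h4 : 4 ≤ N ^ 2 := by nlinarith
    nlinarith
  rw [abs_le] at hs ⊢
  have h1 := key s hs.2
  have h2 := key (-s) (by linarith [hs.1])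
  rw [Real.arsinh_neg] at h2
  constructor <;> linarith

lemma half_log_le_abs_arsinh (N s : ℝ) (hN : 2 ≤ N) (hs : N / 3 ≤ |s|) :
    (Real.log N / 2) ^ 2 ≤ Real.arsinh s ^ 2 := by
  have h0 : 0 ≤ Real.log N := Real.log_nonneg (by linarith)
  have key : ∀ t : ℝ, N / 3 ≤ t → Real.log N / 2 ≤ Real.arsinh t := by
    intro t ht
    refine le_trans ?_ (Real.arsinh_le_arsinh.2 ht)
    have h1 : N / 3 ≤ √(1 + (N / 3) ^ 2) := by
      apply Real.le_sqrt_of_sq_le; linarith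
    have h2 : √(1 + (N / 3) ^ 2) ^ 2 = 1 + (N / 3) ^ 2 := Real.sq_sqrt (by positivity)
    have h1' : 1 ≤ √(1 + (N / 3) ^ 2) := by
      apply Real.le_sqrt_of_sq_le; nlinarith
    have h3 : N ≤ (N / 3 + √(1 + (N / 3) ^ 2)) ^ 2 := by nlinarith [sq_nonneg (N - 2)]
    have h4 := Real.log_le_log (by linarith) h3
    rw [Real.log_pow] at h4
    push_cast at h4
    rw [Real.arsinh]
    linarith
  rcases le_total 0 s with h | h
  · rw [abs_of_nonneg h] at hs
    have := key s hs
    exact pow_le_pow_left₀ (by positivity) this 2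
  · rw [abs_of_nonpos h] at hs
    have := key (-s) hs
    rw [← neg_sq (Real.arsinh s), ← Real.arsinh_neg]
    exact pow_le_pow_left₀ (by positivity) this 2

lemma sum_one_div_one_add_abs_le (N : ℤ) (hN : 2 ≤ N) (f : ℤ → ℝ) (α : ℝ)
    (hf : ∀ t, f (t + 1) = f t + α) (h1 : 1 / 3 ≤ |α|) (h2 : |α| ≤ 1)
    (hb1 : |f (-N + 1)| ≤ 3 * N) (hb2 : |f (N + 1)| ≤ 3 * N) :
    ∑ t ∈ Icc (-N + 1) N, 1 / (1 + |f t|) ≤ 48 * Real.log N := by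
  wlog hα : 0 ≤ α generalizing f α
  · have := this (fun t => - f t) (-α) (fun t => by rw [hf]; ring) (by rwa [abs_neg])
      (by rwa [abs_neg]) (by rwa [abs_neg]) (by rwa [abs_neg]) (by linarith)
    simpa only [abs_neg] using this
  rw [abs_of_nonneg hα] at h1 h2
  have hNR : (2 : ℝ) ≤ N := by exact_mod_cast hN
  have hIco : Icc (-N + 1) N = Ico (-N + 1) (N + 1) := by
    ext t; simp only [mem_Icc, mem_Ico]; omega
  calc ∑ t ∈ Icc (-N + 1) N, 1 / (1 + |f t|)
      ≤ ∑ t ∈ Icc (-N + 1) N, 6 * (Real.arsinh (f (t + 1)) - Real.arsinh (f t)) :=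
        sum_le_sum fun t _ => by rw [hf]; exact one_div_le_arsinh_sub _ _ h1 h2
    _ = 6 * (Real.arsinh (f (N + 1)) - Real.arsinh (f (-N + 1))) := by
        rw [← mul_sum, hIco, sum_Ico_succ_sub (fun t => Real.arsinh (f t)) (by omega)]
    _ ≤ 48 * Real.log N := by
        have h3 := (abs_le.1 (abs_arsinh_le N _ hNR hb1)).1
        have h4 := (abs_le.1 (abs_arsinh_le N _ hNR hb2)).2
        linarith

lemma abs_lineDist_le (a b : ℝ) (ha : |a| ≤ 1) (hb : |b| ≤ 1) (k : ℤ × ℤ) (r : ℝ)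
    (h1 : |(k.1 : ℝ) - 1 / 2| ≤ r) (h2 : |(k.2 : ℝ) - 1 / 2| ≤ r) :
    |lineDist a b k| ≤ 2 * r := by
  refine (abs_add_le _ _).trans ?_
  rw [abs_mul, abs_mul]
  nlinarith [abs_nonneg a, abs_nonneg b, abs_nonneg ((k.1 : ℝ) - 1 / 2),
    abs_nonneg ((k.2 : ℝ) - 1 / 2)]

lemma abs_sub_half_le_of_mem {N t : ℤ} (ht : t ∈ Icc (-N + 1) N) :
    |(t : ℝ) - 1 / 2| ≤ N - 1 / 2 := by
  rw [mem_Icc] at ht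
  have h1 : (-N + 1 : ℝ) ≤ t := by exact_mod_cast ht.1
  have h2 : (t : ℝ) ≤ N := by exact_mod_cast ht.2
  rw [abs_le]; constructor <;> linarith

lemma abs_lineDist_le_of_mem (a b : ℝ) (ha : |a| ≤ 1) (hb : |b| ≤ 1) {N : ℤ} {k : ℤ × ℤ}
    (hk : k ∈ Icc (-N + 1) N ×ˢ Icc (-N + 1) N) : |lineDist a b k| ≤ 2 * N - 1 := by
  rw [mem_product] at hk
  have := abs_lineDist_le a b ha hb k _ (abs_sub_half_le_of_mem hk.1)
    (abs_sub_half_le_of_mem hk.2)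
  linarith

lemma lineDist_swap (a b : ℝ) (k : ℤ × ℤ) : lineDist a b k.swap = lineDist b a k := by
  simp only [lineDist, Prod.fst_swap, Prod.snd_swap]; ring

lemma sum_row_one_div_le (a b : ℝ) (ha : |a| ≤ 1) (hb : |b| ≤ 1) (h : 1 / 3 ≤ |a|) (N : ℤ)
    (hN : 2 ≤ N) (y : ℤ) (hy : y ∈ Icc (-N + 1) N) :
    ∑ x ∈ Icc (-N + 1) N, 1 / (1 + |lineDist a b (x, y)|) ≤ 48 * Real.log N := by
  have hNR : (2 : ℝ) ≤ N := by exact_mod_cast hN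
  have hy' := (abs_sub_half_le_of_mem hy).trans (by linarith : (N : ℝ) - 1 / 2 ≤ N + 1 / 2)
  refine sum_one_div_one_add_abs_le N hN (fun x => lineDist a b (x, y)) a ?_ h ha ?_ ?_
  · intro t; simp only [lineDist]; push_cast; ring
  · refine (abs_lineDist_le a b ha hb _ (N + 1 / 2) ?_ hy').trans (by linarith)
    rw [abs_le]; push_cast; constructor <;> linarith
  · refine (abs_lineDist_le a b ha hb _ (N + 1 / 2) ?_ hy').trans (by linarith)
    rw [abs_le]; push_cast; constructor <;> linarith

lemma abs_le_one_of_sq_add_sq {a b : ℝ} (h : a ^ 2 + b ^ 2 = 1) : |a| ≤ 1 := by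
  rw [abs_le]; constructor <;> nlinarith [sq_nonneg b]

lemma sum_box_one_div_le (a b : ℝ) (hab : a ^ 2 + b ^ 2 = 1) (N : ℤ) (hN : 2 ≤ N) :
    ∑ y ∈ Icc (-N + 1) N, ∑ x ∈ Icc (-N + 1) N, 1 / (1 + |lineDist a b (x, y)|) ≤
      96 * N * Real.log N := by
  have ha := abs_le_one_of_sq_add_sq hab
  have hb := abs_le_one_of_sq_add_sq ((add_comm _ _).trans hab)
  have hcard := card_Icc_box N hN
  rcases le_or_gt (1 / 3) |a| with h | h
  · refine (sum_le_card_nsmul _ _ _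
      fun y hy => sum_row_one_div_le a b ha hb h N hN y hy).trans (le_of_eq ?_)
    rw [nsmul_eq_mul, hcard]; ring
  · have h' : 1 / 3 ≤ |b| := by
      rw [← sq_abs a, ← sq_abs b] at hab
      nlinarith [abs_nonneg a, abs_nonneg b]
    rw [sum_comm]
    refine (sum_le_card_nsmul _ _ (48 * Real.log N) fun x hx => ?_).trans (le_of_eq ?_)
    · refine le_trans (le_of_eq (sum_congr rfl fun y _ => ?_))
        (sum_row_one_div_le b a hb ha h' N hN x hx)
      rw [← lineDist_swap a b (y, x), Prod.swap_prod_mk]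
    · rw [nsmul_eq_mul, hcard]; ring

lemma lineDist_succ_fst (a b : ℝ) (x y : ℤ) :
    lineDist a b (x + 1, y) = lineDist a b (x, y) + a := by
  simp only [lineDist]; push_cast; ring

lemma one_div_min_le {ε s s' p q : ℝ} (hε : 0 < ε) (hs : |s' - s| ≤ 1)
    (hp : ε * (1 + |s|) ≤ p) (hq : ε * (1 + |s'|) ≤ q) :
    1 / min p q ≤ 2 / ε * (1 / (1 + |s|)) := by
  have h1 : |s| ≤ |s'| + 1 := by
    have := abs_sub_abs_le_abs_sub s s'
    rw [abs_sub_comm] at this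
    linarith
  have h2 : ε * (1 + |s|) / 2 ≤ min p q := by
    refine le_min ?_ ?_
    · have : 0 ≤ ε * (1 + |s|) := by positivity
      linarith
    · have := abs_nonneg s'
      nlinarith
  refine (one_div_le_one_div_of_le (by positivity) h2).trans (le_of_eq ?_)
  field_simp

lemma sum_row_one_div_min_le {ε a b : ℝ} (hε : 0 < ε) (ha : |a| ≤ 1) (F : ℤ × ℤ → ℝ)
    (hF : ∀ k, ε * (1 + |lineDist a b k|) ≤ F k) (N y : ℤ) (K : ℝ)
    (h : ∑ x ∈ Icc (-N + 1) N, 1 / (1 + |lineDist a b (x, y)|) ≤ K) :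
    ∑ x ∈ Ico (-N + 1) N, 1 / min (F (x, y)) (F (x + 1, y)) ≤ 2 / ε * K := by
  calc ∑ x ∈ Ico (-N + 1) N, 1 / min (F (x, y)) (F (x + 1, y))
      ≤ ∑ x ∈ Ico (-N + 1) N, 2 / ε * (1 / (1 + |lineDist a b (x, y)|)) :=
        sum_le_sum fun x _ => one_div_min_le hε
          (by rw [lineDist_succ_fst, add_sub_cancel_left]; exact ha) (hF _) (hF _)
    _ ≤ ∑ x ∈ Icc (-N + 1) N, 2 / ε * (1 / (1 + |lineDist a b (x, y)|)) :=
        sum_le_sum_of_subset_of_nonneg Ico_subset_Icc_self fun x _ _ => by positivity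
    _ ≤ 2 / ε * K := by
        rw [← mul_sum]; exact mul_le_mul_of_nonneg_left h (by positivity)

lemma sum_column_one_div_le (a b : ℝ) (hab : a ^ 2 + b ^ 2 = 1) (N : ℤ) (hN : 2 ≤ N)
    (x : ℤ) (hx : x ∈ Icc (N - N / 8) N) :
    ∑ y ∈ Icc (-N + 1) N, 1 / (1 + |lineDist b a (y, x)|) ≤ 48 * Real.log N := by
  have ha := abs_le_one_of_sq_add_sq hab
  have hb := abs_le_one_of_sq_add_sq ((add_comm _ _).trans hab)
  have hNR : (2 : ℝ) ≤ N := by exact_mod_cast hN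
  rw [mem_Icc] at hx
  rcases le_or_gt (1 / 3) |b| with h | h
  · exact sum_row_one_div_le b a hb ha h N hN x (by rw [mem_Icc]; omega)
  · have h' : 2 / 3 ≤ |a| := by
      rw [← sq_abs a, ← sq_abs b] at hab
      nlinarith [abs_nonneg a, abs_nonneg b]
    have hxR : 5 / 8 * (N : ℝ) ≤ x - 1 / 2 := by
      have : 7 * N ≤ 8 * x := by omega
      have : (7 * N : ℝ) ≤ 8 * x := by exact_mod_cast this
      linarith
    have hs : ∀ y ∈ Icc (-N + 1) N, 1 / (1 + |lineDist b a (y, x)|) ≤ 12 / N := by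
      intro y hy
      have hy := abs_sub_half_le_of_mem hy
      have h1 : N / 12 ≤ |lineDist b a (y, x)| := by
        have h2 := abs_sub_abs_le_abs_sub (a * ((x : ℝ) - 1 / 2)) (-(b * ((y : ℝ) - 1 / 2)))
        rw [abs_neg, abs_mul, abs_mul, abs_of_nonneg (by linarith : 0 ≤ (x : ℝ) - 1 / 2),
          sub_neg_eq_add, add_comm (a * _)] at h2
        simp only [lineDist]
        nlinarith [abs_nonneg b, abs_nonneg ((y : ℝ) - 1 / 2)]
      rw [div_le_div_iff₀ (by positivity) (by positivity)]
      linarith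
    refine (sum_le_card_nsmul _ _ _ hs).trans ?_
    rw [nsmul_eq_mul, card_Icc_box N hN]
    have h1 : 2 * (N : ℝ) * (12 / N) = 24 := by field_simp; norm_num
    have h2 := Real.log_le_log (by norm_num) hNR
    have h3 := Real.log_two_gt_d9
    linarith

lemma sum_box_swap (I : Finset ℤ) (g : ℤ × ℤ → ℝ) :
    ∑ k ∈ I ×ˢ I, g k.swap = ∑ k ∈ I ×ˢ I, g k :=
  sum_equiv (Equiv.prodComm ℤ ℤ) (fun k => by simp only [mem_product, Equiv.prodComm_apply,
    Prod.fst_swap, Prod.snd_swap, and_comm]) (fun _ _ => rfl)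

lemma weight_pos {ε a b : ℝ} (hε : 0 < ε) {F : ℤ × ℤ → ℝ}
    (hF : ∀ k, ε * (1 + |lineDist a b k|) ≤ F k) (k : ℤ × ℤ) : 0 < F k :=
  lt_of_lt_of_le (by positivity) (hF k)

lemma poincare_lineDist {ε a b : ℝ} (hε : 0 < ε) (hab : a ^ 2 + b ^ 2 = 1)
    (N : ℤ) (hN : 2 ≤ N) (F u : ℤ × ℤ → ℝ)
    (hF : ∀ k, ε * (1 + |lineDist a b k|) ≤ F k)
    (hF' : ∀ k, F k ≤ 1 / ε * (1 + |lineDist a b k|)) :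
    ∑ k ∈ Icc (-N + 1) N ×ˢ Icc (-N + 1) N, ∑ l ∈ Icc (-N + 1) N ×ˢ Icc (-N + 1) N,
      F k * F l * (u k - u l) ^ 2 ≤
    18432 / ε ^ 2 * (N ^ 2 * Real.log N) * (∑ k ∈ Icc (-N + 1) N ×ˢ Icc (-N + 1) N, F k) *
      (horizontalEnergy N F u + horizontalEnergy N (F ∘ Prod.swap) (u ∘ Prod.swap)) := by
  wlog hle : 1 / 3 ≤ |a| generalizing a b F u
  · have h' : 1 / 3 ≤ |b| := by
      rw [← sq_abs a, ← sq_abs b] at hab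
      nlinarith [abs_nonneg a, abs_nonneg b]
    have key := this ((add_comm _ _).trans hab) (F ∘ Prod.swap) (u ∘ Prod.swap)
      (fun k => by rw [← lineDist_swap]; exact hF k.swap)
      (fun k => by rw [← lineDist_swap]; exact hF' k.swap) h'
    simp only [Function.comp_def, Prod.swap_swap] at key ⊢
    have hswap : ∑ k ∈ Icc (-N + 1) N ×ˢ Icc (-N + 1) N, ∑ l ∈ Icc (-N + 1) N ×ˢ Icc (-N + 1) N,
        F k.swap * F l.swap * (u k.swap - u l.swap) ^ 2 =
        ∑ k ∈ Icc (-N + 1) N ×ˢ Icc (-N + 1) N, ∑ l ∈ Icc (-N + 1) N ×ˢ Icc (-N + 1) N,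
        F k * F l * (u k - u l) ^ 2 := by
      rw [← sum_box_swap _ (fun k => ∑ l ∈ Icc (-N + 1) N ×ˢ Icc (-N + 1) N,
        F k * F l * (u k - u l) ^ 2)]
      exact sum_congr rfl fun k _ =>
        sum_box_swap _ (fun l => F k.swap * F l * (u k.swap - u l) ^ 2)
    rw [hswap, sum_box_swap _ F] at key
    rwa [add_comm (horizontalEnergy N F u)]
  have ha := abs_le_one_of_sq_add_sq hab
  have hb := abs_le_one_of_sq_add_sq ((add_comm _ _).trans hab)
  have hcol : ∀ x ∈ Icc (N - N / 8) N, ∑ y ∈ Ico (-N + 1) N,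
      1 / min ((F ∘ Prod.swap) (y, x)) ((F ∘ Prod.swap) (y + 1, x)) ≤
        2 / ε * (48 * Real.log N) :=
    fun x hx => sum_row_one_div_min_le hε hb (F ∘ Prod.swap)
      (fun k => by rw [← lineDist_swap]; exact hF k.swap) N x _
      (sum_column_one_div_le a b hab N hN x hx)
  refine (sum_sum_sq_sub_le N hN F u (weight_pos hε hF) (2 / ε) (2 / ε * (48 * Real.log N)) ?_
    (fun y hy => sum_row_one_div_min_le hε ha F hF N y _
      (sum_row_one_div_le a b ha hb hle N hN y hy)) hcol).trans (le_of_eq ?_)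
  · intro k hk
    refine (hF' k).trans ?_
    have := abs_lineDist_le_of_mem a b ha hb hk
    calc 1 / ε * (1 + |lineDist a b k|) ≤ 1 / ε * (2 * N) :=
          mul_le_mul_of_nonneg_left (by linarith) (by positivity)
      _ = 2 / ε * N := by ring
  · field_simp
    ring

lemma metroDirichlet2_eq (N : ℤ) (F u : ℤ × ℤ → ℝ)
    (hZ : 0 < ∑ l ∈ Icc (-N + 1) N ×ˢ Icc (-N + 1) N, F l) :
    metroDirichlet2 (Icc (-N + 1) N ×ˢ Icc (-N + 1) N) F u =
      (horizontalEnergy N F u + horizontalEnergy N (F ∘ Prod.swap) (u ∘ Prod.swap)) /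
        (4 * ∑ l ∈ Icc (-N + 1) N ×ˢ Icc (-N + 1) N, F l) := by
  have hfilter : (Icc (-N + 1) N).filter (fun x => x + 1 ∈ Icc (-N + 1) N) =
      Ico (-N + 1) N := by
    ext x; simp only [mem_filter, mem_Icc, mem_Ico]; omega
  have key : ∀ G v : ℤ × ℤ → ℝ, ∀ Z : ℝ, 0 < Z →
      ∑ y ∈ Icc (-N + 1) N, ∑ x ∈ Icc (-N + 1) N, (if x + 1 ∈ Icc (-N + 1) N then
        (v (x + 1, y) - v (x, y)) ^ 2 * (1 / 4 * min (G (x, y) / Z) (G (x + 1, y) / Z)) else 0) =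
      horizontalEnergy N G v / (4 * Z) := by
    intro G v Z hZ
    simp only [← sum_filter, hfilter, horizontalEnergy, sum_div]
    refine sum_congr rfl fun y _ => sum_congr rfl fun x _ => ?_
    rw [min_div_div_right hZ.le]
    field_simp
  rw [metroDirichlet2, add_div, ← key F u _ hZ, ← key (F ∘ Prod.swap) (u ∘ Prod.swap) _ hZ]
  congr 1
  · rw [sum_product_right]
    refine sum_congr rfl fun y hy => sum_congr rfl fun x _ => ?_
    simp only [mem_product, hy, and_true, metroPi2]
  · rw [sum_product]
    refine sum_congr rfl fun x hx => sum_congr rfl fun y _ => ?_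
    simp only [mem_product, hx, true_and, metroPi2, Function.comp, Prod.swap]

lemma metroVar2_mul_sq_le (box : Finset (ℤ × ℤ)) (F u : ℤ × ℤ → ℝ) (hF : ∀ k, 0 < F k)
    (hZ : 0 < ∑ l ∈ box, F l) :
    metroVar2 box F u * (∑ l ∈ box, F l) ^ 2 ≤
      ∑ k ∈ box, ∑ l ∈ box, F k * F l * (u k - u l) ^ 2 := by
  rw [metroVar2, sum_mul]
  refine sum_le_sum fun k _ => ?_
  set Z := ∑ l ∈ box, F l with hZdef
  set m := ∑ l ∈ box, u l * metroPi2 box F l with hm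
  have hmZ : ∑ l ∈ box, F l * u l = m * Z := by
    rw [hm, sum_mul]
    refine sum_congr rfl fun l _ => ?_
    rw [metroPi2, ← hZdef]; field_simp
  have h1 : ∑ l ∈ box, F k * F l * (u k - u l) ^ 2 =
      F k * (Z * (u k - m) ^ 2 + ∑ l ∈ box, F l * (u l - m) ^ 2) := by
    have : ∀ l ∈ box, F k * F l * (u k - u l) ^ 2 =
        F k * (u k - m) ^ 2 * F l + F k * (F l * (u l - m) ^ 2) +
          2 * F k * (u k - m) * m * F l - 2 * F k * (u k - m) * (F l * u l) := fun l _ => by ring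
    rw [sum_congr rfl this, sum_sub_distrib, sum_add_distrib, sum_add_distrib, ← mul_sum,
      ← mul_sum, ← mul_sum, ← mul_sum, hmZ, ← hZdef]
    ring
  have h2 : 0 ≤ ∑ l ∈ box, F l * (u l - m) ^ 2 :=
    sum_nonneg fun l _ => mul_nonneg (hF l).le (sq_nonneg _)
  have h3 : (u k - m) ^ 2 * metroPi2 box F k * Z ^ 2 = F k * (Z * (u k - m) ^ 2) := by
    rw [metroPi2, ← hZdef]; field_simp
  rw [h1, h3]
  exact mul_le_mul_of_nonneg_left (by linarith) (hF k).le

lemma horizontalEnergy_arsinh_le {ε a b : ℝ} (hε : 0 < ε) (hab : a ^ 2 + b ^ 2 = 1)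
    (N : ℤ) (hN : 2 ≤ N) (F : ℤ × ℤ → ℝ)
    (hF' : ∀ k, F k ≤ 1 / ε * (1 + |lineDist a b k|)) :
    horizontalEnergy N F (fun k => Real.arsinh (lineDist a b k)) ≤
      864 / ε * (N * Real.log N) := by
  have ha := abs_le_one_of_sq_add_sq hab
  calc horizontalEnergy N F (fun k => Real.arsinh (lineDist a b k))
      ≤ ∑ y ∈ Icc (-N + 1) N, ∑ x ∈ Icc (-N + 1) N,
          9 / ε * (1 / (1 + |lineDist a b (x, y)|)) := by
        refine sum_le_sum fun y _ => (sum_le_sum fun x _ => ?_).trans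
          (sum_le_sum_of_subset_of_nonneg Ico_subset_Icc_self fun x _ _ => by positivity)
        simp only [lineDist_succ_fst]
        calc min (F (x, y)) (F (x + 1, y)) *
              (Real.arsinh (lineDist a b (x, y) + a) - Real.arsinh (lineDist a b (x, y))) ^ 2
            ≤ 1 / ε * (1 + |lineDist a b (x, y)|) * (9 / (1 + |lineDist a b (x, y)|) ^ 2) :=
              mul_le_mul ((min_le_left _ _).trans (hF' _)) (sq_arsinh_add_sub_arsinh_le _ _ ha)
                (sq_nonneg _) (by positivity)
          _ = 9 / ε * (1 / (1 + |lineDist a b (x, y)|)) := by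
              have : 1 + |lineDist a b (x, y)| ≠ 0 := by positivity
              field_simp
    _ = 9 / ε * ∑ y ∈ Icc (-N + 1) N, ∑ x ∈ Icc (-N + 1) N,
          1 / (1 + |lineDist a b (x, y)|) := by simp only [mul_sum]
    _ ≤ 9 / ε * (96 * N * Real.log N) :=
        mul_le_mul_of_nonneg_left (sum_box_one_div_le a b hab N hN) (by positivity)
    _ = 864 / ε * (N * Real.log N) := by ring

lemma sum_Icc_box_moments (n : ℕ) :
    ∑ x ∈ Icc (-(n : ℤ) + 1) n, ((x : ℝ) - 1 / 2) = 0 ∧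
    ∑ x ∈ Icc (-(n : ℤ) + 1) n, ((x : ℝ) - 1 / 2) ^ 2 = (2 * (n : ℝ) ^ 3 - n / 2) / 3 := by
  induction n with
  | zero => simp
  | succ n ih =>
    have h : Icc (-((n + 1 : ℕ) : ℤ) + 1) (n + 1 : ℕ) =
        insert (-(n : ℤ)) (insert ((n : ℤ) + 1) (Icc (-(n : ℤ) + 1) n)) := by
      ext t; simp only [mem_Icc, mem_insert]; omega
    have h1 : -(n : ℤ) ∉ insert ((n : ℤ) + 1) (Icc (-(n : ℤ) + 1) n) := by
      simp only [mem_Icc, mem_insert]; omega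
    have h2 : (n : ℤ) + 1 ∉ Icc (-(n : ℤ) + 1) n := by
      simp only [mem_Icc]; omega
    rw [h, sum_insert h1, sum_insert h2, sum_insert h1, sum_insert h2, ih.1, ih.2]
    push_cast
    constructor <;> ring

lemma sum_lineDist_sq (a b : ℝ) (hab : a ^ 2 + b ^ 2 = 1) (N : ℤ) (hN : 2 ≤ N) :
    5 / 4 * (N : ℝ) ^ 4 ≤
      ∑ k ∈ Icc (-N + 1) N ×ˢ Icc (-N + 1) N, lineDist a b k ^ 2 := by
  have hcard := card_Icc_box N hN
  have hNR : (2 : ℝ) ≤ N := by exact_mod_cast hN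
  obtain ⟨n, rfl⟩ := Int.eq_ofNat_of_zero_le (by omega : 0 ≤ N)
  obtain ⟨m1, m2⟩ := sum_Icc_box_moments n
  have h : ∑ k ∈ Icc (-(n : ℤ) + 1) n ×ˢ Icc (-(n : ℤ) + 1) n, lineDist a b k ^ 2 =
      2 * n * ((2 * (n : ℝ) ^ 3 - n / 2) / 3) := by
    have h1 : ∀ x ∈ Icc (-(n : ℤ) + 1) n, ∑ y ∈ Icc (-(n : ℤ) + 1) n, lineDist a b (x, y) ^ 2 =
        2 * n * a ^ 2 * ((x : ℝ) - 1 / 2) ^ 2 +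
          b ^ 2 * ((2 * (n : ℝ) ^ 3 - n / 2) / 3) := by
      intro x _
      have h2 : ∀ y ∈ Icc (-(n : ℤ) + 1) n, lineDist a b (x, y) ^ 2 =
          a ^ 2 * ((x : ℝ) - 1 / 2) ^ 2 + 2 * a * b * ((x : ℝ) - 1 / 2) * ((y : ℝ) - 1 / 2) +
            b ^ 2 * ((y : ℝ) - 1 / 2) ^ 2 := fun y _ => by simp only [lineDist]; ring
      rw [sum_congr rfl h2, sum_add_distrib, sum_add_distrib, ← mul_sum, ← mul_sum, ← mul_sum, m1,
        m2, sum_const, nsmul_eq_mul, hcard]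
      push_cast; ring
    rw [sum_product, sum_congr rfl h1, sum_add_distrib, ← mul_sum, m2, sum_const, nsmul_eq_mul,
      hcard]
    push_cast
    linear_combination (2 * n * ((2 * (n : ℝ) ^ 3 - n / 2) / 3)) * hab
  rw [h]
  push_cast at hNR ⊢
  have : 0 ≤ (n : ℝ) ^ 2 * ((n : ℝ) ^ 2 - 4) := by
    refine mul_nonneg (sq_nonneg _) ?_; nlinarith
  linarith

lemma le_sum_arsinh_sq (a b : ℝ) (hab : a ^ 2 + b ^ 2 = 1) (N : ℤ) (hN : 2 ≤ N) :
    (N : ℝ) ^ 3 * Real.log N ^ 2 / 10 ≤ ∑ k ∈ Icc (-N + 1) N ×ˢ Icc (-N + 1) N,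
      (1 + |lineDist a b k|) * Real.arsinh (lineDist a b k) ^ 2 := by
  have ha := abs_le_one_of_sq_add_sq hab
  have hb := abs_le_one_of_sq_add_sq ((add_comm _ _).trans hab)
  have hNR : (2 : ℝ) ≤ N := by exact_mod_cast hN
  have hcard := card_Icc_box N hN
  have hpt : ∀ k ∈ Icc (-N + 1) N ×ˢ Icc (-N + 1) N,
      Real.log N ^ 2 / (8 * N) * (lineDist a b k ^ 2 - N ^ 2 / 9) ≤
        (1 + |lineDist a b k|) * Real.arsinh (lineDist a b k) ^ 2 := by
    intro k hk
    have hk := abs_lineDist_le_of_mem a b ha hb hk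
    set s := lineDist a b k
    rcases le_or_gt ((N : ℝ) / 3) |s| with h | h
    · have h1 := half_log_le_abs_arsinh N s hNR h
      calc Real.log N ^ 2 / (8 * N) * (s ^ 2 - N ^ 2 / 9)
          ≤ Real.log N ^ 2 / (8 * N) * (2 * N * (1 + |s|)) := by
            refine mul_le_mul_of_nonneg_left ?_ (by positivity)
            rw [← sq_abs s]
            nlinarith [abs_nonneg s]
        _ = (1 + |s|) * (Real.log N / 2) ^ 2 := by field_simp; ring
        _ ≤ _ := mul_le_mul_of_nonneg_left h1 (by positivity)
    · refine le_trans (mul_nonpos_of_nonneg_of_nonpos (by positivity) ?_) (by positivity)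
      rw [← sq_abs s]
      nlinarith [abs_nonneg s]
  refine le_trans ?_ (sum_le_sum hpt)
  rw [← mul_sum, sum_sub_distrib, sum_const, nsmul_eq_mul, card_product, Nat.cast_mul, hcard]
  have h1 := sum_lineDist_sq a b hab N hN
  calc (N : ℝ) ^ 3 * Real.log N ^ 2 / 10 = Real.log N ^ 2 / (8 * N) * (4 / 5 * N ^ 4) := by
        field_simp; ring
    _ ≤ _ := by
        refine mul_le_mul_of_nonneg_left ?_ (by positivity)
        have : (0 : ℝ) ≤ (N : ℝ) ^ 4 := by positivity
        linarith [(by ring : 2 * (N : ℝ) * (2 * N) * (N ^ 2 / 9) = 4 / 9 * N ^ 4)]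

lemma sum_box_eq_zero_of_odd (N : ℤ) (g : ℤ × ℤ → ℝ)
    (hg : ∀ k : ℤ × ℤ, g (1 - k.1, 1 - k.2) = - g k) :
    ∑ k ∈ Icc (-N + 1) N ×ˢ Icc (-N + 1) N, g k = 0 := by
  have h : ∑ k ∈ Icc (-N + 1) N ×ˢ Icc (-N + 1) N, g k =
      ∑ k ∈ Icc (-N + 1) N ×ˢ Icc (-N + 1) N, - g k := by
    refine sum_nbij' (fun k => (1 - k.1, 1 - k.2)) (fun k => (1 - k.1, 1 - k.2)) ?_ ?_ ?_ ?_ ?_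
    · intro k hk; simp only [mem_product, mem_Icc] at hk ⊢; omega
    · intro k hk; simp only [mem_product, mem_Icc] at hk ⊢; omega
    · intro k _; simp
    · intro k _; simp
    · intro k _; rw [hg, neg_neg]
  rw [sum_neg_distrib] at h
  linarith

lemma le_metroVar2_arsinh {ε a b : ℝ} (hε : 0 < ε) (hab : a ^ 2 + b ^ 2 = 1)
    (N : ℤ) (hN : 2 ≤ N) (F : ℤ × ℤ → ℝ)
    (hF : ∀ k, ε * (1 + |lineDist a b k|) ≤ F k)
    (hsymm : ∀ k : ℤ × ℤ, F (1 - k.1, 1 - k.2) = F k)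
    (hZ : 0 < ∑ l ∈ Icc (-N + 1) N ×ˢ Icc (-N + 1) N, F l) :
    ε * ((N : ℝ) ^ 3 * Real.log N ^ 2 / 10) / (∑ l ∈ Icc (-N + 1) N ×ˢ Icc (-N + 1) N, F l) ≤
      metroVar2 (Icc (-N + 1) N ×ˢ Icc (-N + 1) N) F
        (fun k => Real.arsinh (lineDist a b k)) := by
  have hmean : ∑ l ∈ Icc (-N + 1) N ×ˢ Icc (-N + 1) N, Real.arsinh (lineDist a b l) *
      metroPi2 (Icc (-N + 1) N ×ˢ Icc (-N + 1) N) F l = 0 := by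
    refine sum_box_eq_zero_of_odd N _ fun k => ?_
    have : lineDist a b (1 - k.1, 1 - k.2) = - lineDist a b k := by
      simp only [lineDist]; push_cast; ring
    rw [this, Real.arsinh_neg, metroPi2, hsymm, metroPi2]
    ring
  rw [metroVar2, hmean, div_le_iff₀ hZ, sum_mul]
  refine (mul_le_mul_of_nonneg_left (le_sum_arsinh_sq a b hab N hN) hε.le).trans ?_
  rw [mul_sum]
  refine sum_le_sum fun k _ => ?_
  rw [metroPi2, sub_zero, mul_assoc, div_mul_cancel₀ _ hZ.ne']
  nlinarith [hF k, sq_nonneg (Real.arsinh (lineDist a b k))]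

lemma metroGap2_bounds {ε a b : ℝ} (hε : 0 < ε) (hab : a ^ 2 + b ^ 2 = 1)
    (N : ℤ) (hN : 2 ≤ N) (F : ℤ × ℤ → ℝ)
    (hF : ∀ k, ε * (1 + |lineDist a b k|) ≤ F k)
    (hF' : ∀ k, F k ≤ 1 / ε * (1 + |lineDist a b k|))
    (hsymm : ∀ k : ℤ × ℤ, F (1 - k.1, 1 - k.2) = F k) :
    ε ^ 2 / 73728 / ((N : ℝ) ^ 2 * Real.log N) ≤
      metroGap2 (Icc (-N + 1) N ×ˢ Icc (-N + 1) N) F ∧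
    metroGap2 (Icc (-N + 1) N ×ˢ Icc (-N + 1) N) F ≤
      4320 / ε ^ 2 / ((N : ℝ) ^ 2 * Real.log N) := by
  have hpos := weight_pos hε hF
  have hNR : (2 : ℝ) ≤ N := by exact_mod_cast hN
  have hlog : 0 < Real.log N := Real.log_pos (by linarith)
  have hZ : 0 < ∑ l ∈ Icc (-N + 1) N ×ˢ Icc (-N + 1) N, F l :=
    sum_pos (fun k _ => hpos k) ⟨(1, 1), by simp only [mem_product, mem_Icc]; omega⟩
  set box := Icc (-N + 1) N ×ˢ Icc (-N + 1) N with hbox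
  have hE0 : ∀ u, 0 ≤ metroDirichlet2 box F u := fun u => by
    rw [hbox, metroDirichlet2_eq N F u hZ]
    exact div_nonneg (add_nonneg (horizontalEnergy_nonneg N F u hpos)
      (horizontalEnergy_nonneg N _ _ fun k => hpos k.swap)) (by positivity)
  have hV0 : ∀ u, 0 ≤ metroVar2 box F u := fun u =>
    sum_nonneg fun k _ => mul_nonneg (sq_nonneg _) (div_nonneg (hpos k).le hZ.le)
  have hvar := le_metroVar2_arsinh hε hab N hN F hF hsymm hZ
  rw [← hbox] at hvar
  have hvar0 : 0 < ε * ((N : ℝ) ^ 3 * Real.log N ^ 2 / 10) / ∑ l ∈ box, F l := by positivity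
  have hmem : metroDirichlet2 box F (fun k => Real.arsinh (lineDist a b k)) /
      metroVar2 box F (fun k => Real.arsinh (lineDist a b k)) ∈
      {r : ℝ | ∃ u : ℤ × ℤ → ℝ, metroVar2 box F u ≠ 0 ∧
        r = metroDirichlet2 box F u / metroVar2 box F u} :=
    ⟨_, (hvar0.trans_le hvar).ne', rfl⟩
  constructor
  · refine le_csInf ⟨_, hmem⟩ ?_
    rintro r ⟨u, hu, rfl⟩
    have hu0 : 0 < metroVar2 box F u := lt_of_le_of_ne (hV0 u) hu.symm
    rw [div_le_div_iff₀ (by positivity) hu0]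
    have h1 := (metroVar2_mul_sq_le box F u hpos hZ).trans
      (poincare_lineDist hε hab N hN F u hF hF')
    have h2 := metroDirichlet2_eq N F u hZ
    rw [← hbox] at h1 h2
    rw [eq_div_iff (by positivity)] at h2
    rw [← h2] at h1
    have h3 : metroVar2 box F u ≤
        73728 / ε ^ 2 * (N ^ 2 * Real.log N) * metroDirichlet2 box F u := by
      refine le_of_mul_le_mul_right (h1.trans (le_of_eq ?_)) (pow_pos hZ 2)
      ring
    calc ε ^ 2 / 73728 * metroVar2 box F u
        ≤ ε ^ 2 / 73728 * (73728 / ε ^ 2 * (N ^ 2 * Real.log N) * metroDirichlet2 box F u) :=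
          mul_le_mul_of_nonneg_left h3 (by positivity)
      _ = metroDirichlet2 box F u * (N ^ 2 * Real.log N) := by field_simp
  · refine (csInf_le ⟨0, ?_⟩ hmem).trans ?_
    · rintro r ⟨u, -, rfl⟩
      exact div_nonneg (hE0 u) (hV0 u)
    · have h1 := horizontalEnergy_arsinh_le hε hab N hN F hF'
      have h2 := horizontalEnergy_arsinh_le hε ((add_comm _ _).trans hab) N hN (F ∘ Prod.swap)
        (fun k => by rw [← lineDist_swap]; exact hF' k.swap)
      have hE : metroDirichlet2 box F (fun k => Real.arsinh (lineDist a b k)) ≤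
          432 / ε * (N * Real.log N) / ∑ l ∈ box, F l := by
        rw [hbox, metroDirichlet2_eq N F _ hZ, ← hbox,
          div_le_div_iff₀ (by positivity) hZ]
        simp only [Function.comp_def, lineDist_swap] at h2 ⊢
        refine (mul_le_mul_of_nonneg_right (add_le_add h1 h2) hZ.le).trans (le_of_eq ?_)
        ring
      calc _ ≤ (432 / ε * (N * Real.log N) / ∑ l ∈ box, F l) /
            (ε * ((N : ℝ) ^ 3 * Real.log N ^ 2 / 10) / ∑ l ∈ box, F l) :=
            div_le_div₀ (by positivity) hE hvar0 hvar
        _ = 4320 / ε ^ 2 / ((N : ℝ) ^ 2 * Real.log N) := by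
            field_simp
            ring

/-- valley effect, `α = 1`: for the target proportional to
`1 + A·d((x₁-1/2)/N,(x₂-1/2)/N), L)` with `L = {a·z₁+b·z₂=0}`, `a²+b²=1`,
and `εA ≤ N ≤ A/ε`, the spectral gap on `{-N+1,…,N}²` is of order
`1/(N² log N)`. -/
theorem gap_valley_critical (ε : ℝ) (hε0 : 0 < ε) (hε1 : ε ≤ 1) :
    ∃ c C : ℝ, 0 < c ∧ 0 < C ∧
    ∀ (a b A : ℝ) (N : ℤ), a ^ 2 + b ^ 2 = 1 → 0 < A → 2 ≤ N →
      ε * A ≤ (N : ℝ) → (N : ℝ) ≤ A / ε →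
      c / ((N : ℝ) ^ 2 * Real.log N) ≤
        metroGap2 (Finset.Icc (-N + 1) N ×ˢ Finset.Icc (-N + 1) N)
          (fun k => 1 + A * |a * ((k.1 : ℝ) - 1 / 2) / (N : ℝ) +
            b * ((k.2 : ℝ) - 1 / 2) / (N : ℝ)|) ∧
      metroGap2 (Finset.Icc (-N + 1) N ×ˢ Finset.Icc (-N + 1) N)
          (fun k => 1 + A * |a * ((k.1 : ℝ) - 1 / 2) / (N : ℝ) +
            b * ((k.2 : ℝ) - 1 / 2) / (N : ℝ)|) ≤ C / ((N : ℝ) ^ 2 * Real.log N) := by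

  refine ⟨ε ^ 2 / 73728, 4320 / ε ^ 2, by positivity, by positivity, ?_⟩
  intro a b A N hab hA hN h1 h2
  have hNR : (2 : ℝ) ≤ N := by exact_mod_cast hN
  have hN0 : (0 : ℝ) < N := by linarith
  have hF : (fun k : ℤ × ℤ => 1 + A * |a * ((k.1 : ℝ) - 1 / 2) / (N : ℝ) +
      b * ((k.2 : ℝ) - 1 / 2) / (N : ℝ)|) = fun k => 1 + A / N * |lineDist a b k| := by
    funext k
    rw [← add_div, abs_div, abs_of_pos hN0, lineDist]
    ring
  have hle : A / N ≤ 1 / ε := by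
    rw [div_le_div_iff₀ hN0 hε0]; linarith
  have hge : ε ≤ A / N := by
    rw [le_div_iff₀ hN0]
    rw [le_div_iff₀ hε0] at h2
    linarith
  have hinv : 1 ≤ 1 / ε := by rw [le_div_iff₀ hε0]; linarith
  rw [hF]
  refine metroGap2_bounds hε0 hab N hN _ (fun k => ?_) (fun k => ?_) (fun k => ?_)
  · nlinarith [abs_nonneg (lineDist a b k)]
  · nlinarith [abs_nonneg (lineDist a b k)]
  · have : lineDist a b (1 - k.1, 1 - k.2) = - lineDist a b k := by
      simp only [lineDist]; push_cast; ring
    simp only [this, abs_neg]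
end
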